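/- arXiv:2209.12837 — 3 statements merged into one kernel-verified Lean document; each statement's English description precedes it below -/
import Mathlib

section
/- Let r₁, r₂ be natural numbers with r₁ + r₂ ≥ 1, and let s be a complex number with Re(s) > 1/2. Suppose F : ℂ → ℂ is complex-differentiable at every point w ≠ 1 and satisfies, for all w with Re(w) > 1, F(w) = (s − 1/2)^(−w) + (r₁ + r₂ − 1)·s^(−w) + (r₁ + r₂)·∑_{k=1}^∞ (2k + s)^(−w) + r₂·∑_{k=0}^∞ (2k + 1 + s)^(−w) (powers taken with the principal branch). Then exp(−F′(0)) = (s − 1/2)·s^(−1)·(Γ_ℝ(s)^(r₁) · Γ_ℂ(s)^(r₂) · (√(2π))^((r₁+2r₂)·s))^(−1) · (2√π)^(r₁) · (2√(2π))^(r₂). -/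
/-- The real gamma factor `Γ_ℝ(s) = Γ(s/2)·π^(−s/2)`. -/
noncomputable def GammaR (s : ℂ) : ℂ :=
  Complex.Gamma (s / 2) * (Real.pi : ℂ) ^ (-(s / 2))

/-- The complex gamma factor `Γ_ℂ(s) = 2·(2π)^(−s)·Γ(s)`. -/
noncomputable def GammaC (s : ℂ) : ℂ :=
  2 * (2 * Real.pi : ℂ) ^ (-s) * Complex.Gamma s

open Filter Topology

namespace RiemannDet

/-- Euler–Maclaurin approximants of the Hurwitz zeta function. -/
noncomputable def GN (a : ℂ) (N : ℕ) (w : ℂ) : ℂ :=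
  ∑ k ∈ Finset.range N, ((k : ℂ) + a) ^ (-w) + (1 / 2) * ((N : ℂ) + a) ^ (-w)
    + ((N : ℂ) + a) ^ (1 - w) / (w - 1)

/-- A convex bounded domain containing `0`, avoiding `1` and meeting `1 < re w`. -/
def UU : Set ℂ := {w | -1 / 2 < w.re} ∩ {w | w.re - w.im < 1} ∩ Metric.ball 0 4

lemma UU_open : IsOpen UU := by
  refine ((isOpen_lt continuous_const Complex.continuous_re).inter
    (isOpen_lt (Complex.continuous_re.sub Complex.continuous_im) continuous_const)).inter
    Metric.isOpen_ball

lemma UU_convex : Convex ℝ UU := by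
  refine ((?_ : Convex ℝ {w : ℂ | -1 / 2 < w.re}).inter ?_).inter (convex_ball _ _)
  · exact convex_halfSpace_re_gt _
  · refine convex_halfSpace_lt (f := fun w : ℂ => w.re - w.im) ?_ 1
    constructor
    · intro x y; simp; ring
    · intro c x; simp; ring

lemma zero_mem_UU : (0 : ℂ) ∈ UU := by simp [UU]; norm_num

lemma ne_one_of_mem {w : ℂ} (hw : w ∈ UU) : w ≠ 1 := by
  rintro rfl
  have := hw.1.2
  simp at this

lemma pt_mem_UU : (2 + 2 * Complex.I : ℂ) ∈ UU := by
  refine ⟨⟨?_, ?_⟩, ?_⟩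
  · simp; norm_num
  · simp
  · rw [mem_ball_zero_iff]
    have : ‖(2 + 2 * Complex.I : ℂ)‖ ^ 2 = 8 := by
      rw [← Complex.normSq_eq_norm_sq, Complex.normSq_apply]; simp; norm_num
    nlinarith [norm_nonneg (2 + 2 * Complex.I : ℂ)]

lemma norm_cpow_le' (y z : ℂ) :
    ‖y ^ z‖ ≤ ‖y‖ ^ z.re * Real.exp (Real.pi * |z.im|) := by
  refine (Complex.norm_cpow_le y z).trans ?_
  rw [div_eq_mul_inv, ← Real.exp_neg]
  gcongr
  calc -(Complex.arg y * z.im) ≤ |Complex.arg y * z.im| := neg_le_abs _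
    _ = |Complex.arg y| * |z.im| := abs_mul _ _
    _ ≤ _ := by gcongr; exact Complex.abs_arg_le_pi y

lemma add_re_pos {x : ℂ} (hx : 0 < x.re) {t : ℝ} (ht : 0 ≤ t) : 0 < (x + (t : ℂ)).re := by
  simp; linarith

lemma hasDerivAt_cp {x : ℂ} (hx : 0 < x.re) (z : ℂ) {t : ℝ} (ht : 0 ≤ t) :
    HasDerivAt (fun t : ℝ => (x + (t : ℂ)) ^ z) (z * (x + (t : ℂ)) ^ (z - 1)) t := by
  have h1 : HasDerivAt (fun t : ℝ => (x + (t : ℂ))) 1 t :=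
    (Complex.ofRealCLM.hasDerivAt (x := t)).const_add x |>.congr_deriv (by simp)
  have h2 : HasDerivAt (fun y : ℂ => y ^ z) (z * (x + (t : ℂ)) ^ (z - 1)) (x + (t : ℂ)) := by
    have := (hasDerivAt_id (x + (t : ℂ))).cpow_const (c := z) (Or.inl (add_re_pos hx ht))
    simpa using this
  have h3 := h2.comp t h1
  rw [mul_one] at h3
  exact h3

lemma trap_bound {x : ℂ} (hx : 0 < x.re) {w : ℂ} (hw : w ≠ 1) {M : ℝ}
    (hM : ∀ t : ℝ, 0 ≤ t → t ≤ 1 → ‖w * (w + 1) * (x + (t : ℂ)) ^ (-w - 2)‖ ≤ M) :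
    ‖((x + 1) ^ (1 - w) - x ^ (1 - w)) / (1 - w) - (x ^ (-w) + (x + 1) ^ (-w)) / 2‖ ≤ M := by
  have h1w : (1 - w) ≠ 0 := sub_ne_zero.mpr hw.symm
  have hid : ∀ t : ℝ, HasDerivAt (fun t : ℝ => (t : ℂ)) 1 t := fun t => by
    exact (Complex.ofRealCLM.hasDerivAt (x := t)).congr_deriv (by simp)
  have hM0 : 0 ≤ M := (norm_nonneg _).trans (hM 0 le_rfl zero_le_one)
  set φ : ℝ → ℂ := fun t => ((x + (t : ℂ)) ^ (1 - w) - x ^ (1 - w)) / (1 - w)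
    - (t : ℂ) * (x ^ (-w) + (x + (t : ℂ)) ^ (-w)) / 2 with hφ
  set ψ : ℝ → ℂ := fun t => ((x + (t : ℂ)) ^ (-w) - x ^ (-w)) / 2
    + (t : ℂ) * (w * (x + (t : ℂ)) ^ (-w - 1)) / 2 with hψ
  have hφd : ∀ t : ℝ, 0 ≤ t → HasDerivAt φ (ψ t) t := by
    intro t ht
    have e1 := ((hasDerivAt_cp hx (1 - w) ht).sub_const (x ^ (1 - w))).div_const (1 - w)
    have e2 := ((hid t).mul ((hasDerivAt_cp hx (-w) ht).const_add (x ^ (-w)))).div_const 2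
    refine (e1.sub e2).congr_deriv ?_
    have : (1 - w - 1) = -w := by ring
    simp only [hψ, this]
    field_simp
    ring
  have hψd : ∀ t : ℝ, 0 ≤ t →
      HasDerivAt ψ (-(t / 2) * (w * (w + 1) * (x + (t : ℂ)) ^ (-w - 2))) t := by
    intro t ht
    have e1 := ((hasDerivAt_cp hx (-w) ht).sub_const (x ^ (-w))).div_const 2
    have e2 := ((hid t).mul ((hasDerivAt_cp hx (-w - 1) ht).const_mul w)).div_const 2
    refine (e1.add e2).congr_deriv ?_
    have : (-w - 1 - 1) = -w - 2 := by ring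
    simp only [this]
    ring
  have hψ0 : ψ 0 = 0 := by simp [hψ]
  have hφ0 : φ 0 = 0 := by simp [hφ]
  have hψb : ∀ t : ℝ, 0 ≤ t → t ≤ 1 → ‖ψ t‖ ≤ M := by
    intro t ht ht1
    have := norm_image_sub_le_of_norm_deriv_le_segment' (f := ψ) (a := 0) (b := 1) (C := M)
      (fun y hy => (hψd y hy.1).hasDerivWithinAt) (fun y hy => by
        rw [norm_mul]
        have h2 : ‖-((y : ℂ) / 2)‖ ≤ 1 := by
          rw [norm_neg, norm_div, Complex.norm_real, Real.norm_of_nonneg hy.1]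
          simp; linarith [hy.2]
        calc _ ≤ 1 * M := mul_le_mul h2 (hM y hy.1 hy.2.le) (norm_nonneg _) zero_le_one
          _ = M := one_mul M) t ⟨ht, ht1⟩
    rw [hψ0, sub_zero, sub_zero] at this
    nlinarith
  have := norm_image_sub_le_of_norm_deriv_le_segment_01' (f := φ) (f' := ψ) (C := M)
    (fun y hy => (hφd y hy.1).hasDerivWithinAt) (fun y hy => hψb y hy.1 hy.2.le)
  rw [hφ0, sub_zero] at this
  simpa [hφ] using this

lemma GN_succ (a : ℂ) (N : ℕ) {w : ℂ} (hw : w ≠ 1) :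
    GN a (N + 1) w - GN a N w =
      -(((((N : ℂ) + a) + 1) ^ (1 - w) - ((N : ℂ) + a) ^ (1 - w)) / (1 - w)
        - (((N : ℂ) + a) ^ (-w) + (((N : ℂ) + a) + 1) ^ (-w)) / 2) := by
  have h1w : (1 - w) ≠ 0 := sub_ne_zero.mpr hw.symm
  have h2w : (w - 1) ≠ 0 := sub_ne_zero.mpr hw
  have : ((N + 1 : ℕ) : ℂ) + a = (N : ℂ) + a + 1 := by push_cast; ring
  unfold GN
  rw [Finset.sum_range_succ, this, ← neg_sub w 1, div_neg]
  ring

/-- The bounding constant. -/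
noncomputable def CC : ℝ := 20 * Real.exp (Real.pi * 4)

lemma GN_diff_bound {a : ℂ} (ha : 0 < a.re) (k : ℕ) {w : ℂ} (hw : w ∈ UU) :
    ‖GN a (k + 1 + 1) w - GN a (k + 1) w‖ ≤ CC * ((k : ℝ) + 1) ^ (-(3 / 2) : ℝ) := by
  rw [GN_succ a _ (ne_one_of_mem hw), norm_neg]
  have hk : (0 : ℝ) ≤ k := Nat.cast_nonneg k
  have hw4 : ‖w‖ < 4 := mem_ball_zero_iff.mp hw.2
  have hwr : -1 / 2 < w.re := hw.1.1
  refine trap_bound (by simp; linarith) (ne_one_of_mem hw) ?_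
  intro t ht ht1
  set y : ℂ := ((k + 1 : ℕ) : ℂ) + a + t with hy
  have hyre : (k : ℝ) + 1 ≤ y.re := by simp [hy]; linarith
  have hyn : (k : ℝ) + 1 ≤ ‖y‖ := hyre.trans (Complex.re_le_norm y)
  have h1 := norm_cpow_le' y (-w - 2)
  have h2 : ‖y‖ ^ (-w - 2).re ≤ ((k : ℝ) + 1) ^ (-(3 / 2) : ℝ) := by
    calc _ ≤ ‖y‖ ^ (-(3 / 2) : ℝ) :=
          Real.rpow_le_rpow_of_exponent_le (by linarith) (by simp; linarith)
      _ ≤ _ := Real.rpow_le_rpow_of_nonpos (by linarith) hyn (by norm_num)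
  have h3 : Real.exp (Real.pi * |(-w - 2).im|) ≤ Real.exp (Real.pi * 4) := by
    gcongr
    simp
    exact (Complex.abs_im_le_norm w).trans hw4.le
  have h4 : ‖w * (w + 1)‖ ≤ 20 := by
    rw [norm_mul]
    have : ‖w + 1‖ ≤ ‖w‖ + 1 := by simpa using norm_add_le w 1
    nlinarith [norm_nonneg w, norm_nonneg (w + 1)]
  rw [norm_mul]
  calc _ ≤ 20 * (((k : ℝ) + 1) ^ (-(3 / 2) : ℝ) * Real.exp (Real.pi * 4)) := by
        gcongr
        exact h1.trans (by gcongr)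
    _ = _ := by unfold CC; ring

lemma summable_bd : Summable (fun k : ℕ => CC * ((k : ℝ) + 1) ^ (-(3 / 2) : ℝ)) := by
  refine Summable.mul_left _ ?_
  have := (summable_nat_add_iff 1).mpr
    (Real.summable_nat_rpow (p := -(3 / 2)).mpr (by norm_num))
  simpa using this

lemma ne_zero_na {a : ℂ} (ha : 0 < a.re) (k : ℕ) : (k : ℂ) + a ≠ 0 := by
  intro h
  have := congrArg Complex.re h
  simp at this
  have hk : (0 : ℝ) ≤ k := Nat.cast_nonneg k
  linarith

lemma hasDerivAt_GN {a : ℂ} (ha : 0 < a.re) (N : ℕ) {w : ℂ} (hw : w ≠ 1) :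
    HasDerivAt (GN a N) (∑ k ∈ Finset.range N,
        ((k : ℂ) + a) ^ (-w) * Complex.log ((k : ℂ) + a) * (-1)
      + (1 / 2) * (((N : ℂ) + a) ^ (-w) * Complex.log ((N : ℂ) + a) * (-1))
      + (((N : ℂ) + a) ^ (1 - w) * Complex.log ((N : ℂ) + a) * (-1) * (w - 1)
        - ((N : ℂ) + a) ^ (1 - w) * 1) / (w - 1) ^ 2) w := by
  have h2w : (w - 1) ≠ 0 := sub_ne_zero.mpr hw
  have hn : ∀ k : ℕ, HasDerivAt (fun w : ℂ => ((k : ℂ) + a) ^ (-w))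
      (((k : ℂ) + a) ^ (-w) * Complex.log ((k : ℂ) + a) * (-1)) w := fun k =>
    (hasDerivAt_neg w).const_cpow (Or.inl (ne_zero_na ha k))
  have hn' : HasDerivAt (fun w : ℂ => ((N : ℂ) + a) ^ (1 - w))
      (((N : ℂ) + a) ^ (1 - w) * Complex.log ((N : ℂ) + a) * (-1)) w :=
    ((hasDerivAt_id w).const_sub 1).const_cpow (Or.inl (ne_zero_na ha N))
  exact ((HasDerivAt.fun_sum fun k _ => hn k).add ((hn N).const_mul (1 / 2))).add
    (hn'.div ((hasDerivAt_id w).sub_const 1) h2w)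

/-- The continuation of the Hurwitz zeta function on `UU`. -/
noncomputable def GG (a w : ℂ) : ℂ :=
  GN a 1 w + ∑' k : ℕ, (GN a (k + 1 + 1) w - GN a (k + 1) w)

lemma GN_diffOn {a : ℂ} (ha : 0 < a.re) (N : ℕ) : DifferentiableOn ℂ (GN a N) UU :=
  fun _ hw => (hasDerivAt_GN ha N (ne_one_of_mem hw)).differentiableAt.differentiableWithinAt

lemma GG_diffOn {a : ℂ} (ha : 0 < a.re) : DifferentiableOn ℂ (GG a) UU := by
  refine (GN_diffOn ha 1).add ?_
  exact Complex.differentiableOn_tsum_of_summable_norm summable_bd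
    (fun k => (GN_diffOn ha _).sub (GN_diffOn ha _)) UU_open
    (fun k w hw => GN_diff_bound ha k hw)

lemma GG_tendsto {a : ℂ} (ha : 0 < a.re) {w : ℂ} (hw : w ∈ UU) :
    Tendsto (fun N => GN a (N + 1) w) atTop (𝓝 (GG a w)) := by
  have hs : Summable (fun k : ℕ => GN a (k + 1 + 1) w - GN a (k + 1) w) :=
    Summable.of_norm_bounded summable_bd (fun k => GN_diff_bound ha k hw)
  have := (hs.hasSum.tendsto_sum_nat).const_add (GN a 1 w)
  refine this.congr fun N => ?_
  rw [Finset.sum_range_sub (fun k => GN a (k + 1) w)]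
  simp

lemma GG_deriv_tendsto {a : ℂ} (ha : 0 < a.re) {w : ℂ} (hw : w ∈ UU) :
    Tendsto (fun N => deriv (GN a (N + 1)) w) atTop (𝓝 (deriv (GG a) w)) := by
  have hd : ∀ N, DifferentiableAt ℂ (GN a N) w := fun N =>
    (GN_diffOn ha N).differentiableAt (UU_open.mem_nhds hw)
  have hdo : ∀ k : ℕ, DifferentiableOn ℂ (fun w => GN a (k + 1 + 1) w - GN a (k + 1) w) UU :=
    fun k => (GN_diffOn ha _).sub (GN_diffOn ha _)
  have hs := Complex.hasSum_deriv_of_summable_norm summable_bd hdo UU_open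
    (fun k w hw => GN_diff_bound ha k hw) hw
  have hds : DifferentiableAt ℂ
      (fun w => ∑' k : ℕ, (GN a (k + 1 + 1) w - GN a (k + 1) w)) w :=
    (Complex.differentiableOn_tsum_of_summable_norm summable_bd hdo UU_open
      (fun k w hw => GN_diff_bound ha k hw)).differentiableAt (UU_open.mem_nhds hw)
  have e : deriv (GG a) w = deriv (GN a 1) w
      + deriv (fun w => ∑' k : ℕ, (GN a (k + 1 + 1) w - GN a (k + 1) w)) w :=
    ((hd 1).hasDerivAt.add hds.hasDerivAt).deriv
  rw [e]
  refine (hs.tendsto_sum_nat.const_add (deriv (GN a 1) w)).congr fun N => ?_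
  have : ∀ k : ℕ, deriv (fun w => GN a (k + 1 + 1) w - GN a (k + 1) w) w
      = deriv (GN a (k + 1 + 1)) w - deriv (GN a (k + 1)) w := fun k =>
    ((hd _).hasDerivAt.sub (hd _).hasDerivAt).deriv
  simp only [this]
  rw [Finset.sum_range_sub (fun k => deriv (GN a (k + 1)) w)]
  simp

lemma GG_zero {a : ℂ} (ha : 0 < a.re) : GG a 0 = 1 / 2 - a := by
  refine tendsto_nhds_unique (GG_tendsto ha zero_mem_UU) ?_
  refine tendsto_const_nhds.congr fun N => ?_
  simp [GN]
  ring

lemma norm_na_ge {a : ℂ} (ha : 0 < a.re) (k : ℕ) : (k : ℝ) ≤ ‖(k : ℂ) + a‖ := by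
  refine le_trans ?_ (Complex.re_le_norm _)
  simp; exact ha.le

lemma tendsto_na_cpow {a : ℂ} (ha : 0 < a.re) {z : ℂ} (hz : z.re < 0) :
    Tendsto (fun N : ℕ => ((N : ℂ) + a) ^ z) atTop (𝓝 0) := by
  have h : Tendsto (fun N : ℕ => ‖(N : ℂ) + a‖) atTop atTop :=
    tendsto_atTop_mono (norm_na_ge ha) tendsto_natCast_atTop_atTop
  have h2 := ((tendsto_rpow_neg_atTop (neg_pos.mpr hz)).comp h).mul_const
    (Real.exp (Real.pi * |z.im|))
  rw [zero_mul] at h2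
  refine squeeze_zero_norm (fun N => ?_) h2
  simpa using norm_cpow_le' ((N : ℂ) + a) z

lemma summable_na {a : ℂ} (ha : 0 < a.re) {w : ℂ} (hw : 1 < w.re) :
    Summable (fun k : ℕ => ((k : ℂ) + a) ^ (-w)) := by
  rw [← summable_nat_add_iff 1]
  have h0 : Summable (fun k : ℕ => ((k + 1 : ℕ) : ℝ) ^ (-w.re)) :=
    (summable_nat_add_iff 1).mpr (Real.summable_nat_rpow (p := -w.re).mpr (by linarith))
  refine Summable.of_norm_bounded (h0.mul_right (Real.exp (Real.pi * |(-w).im|))) fun k => ?_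
  refine (norm_cpow_le' _ _).trans ?_
  gcongr
  rw [Complex.neg_re]
  exact Real.rpow_le_rpow_of_nonpos (by positivity) (norm_na_ge ha (k + 1)) (by linarith)

lemma GG_eq {a : ℂ} (ha : 0 < a.re) {w : ℂ} (hw : w ∈ UU) (hw1 : 1 < w.re) :
    GG a w = ∑' k : ℕ, ((k : ℂ) + a) ^ (-w) := by
  refine tendsto_nhds_unique (GG_tendsto ha hw) ?_
  refine (tendsto_add_atTop_iff_nat (f := fun N => GN a N w) 1).mpr ?_
  have h1 := (summable_na ha hw1).hasSum.tendsto_sum_nat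
  have h2 := (tendsto_na_cpow ha (z := -w) (by simp; linarith)).const_mul (1 / 2)
  have h3 := (tendsto_na_cpow ha (z := 1 - w) (by simp; linarith)).div_const (w - 1)
  simpa [GN] using (h1.add h2).add h3

lemma deriv_GN_zero {a : ℂ} (ha : 0 < a.re) (N : ℕ) :
    deriv (GN a N) 0 = -∑ k ∈ Finset.range N, Complex.log ((k : ℂ) + a)
      - (1 / 2) * Complex.log ((N : ℂ) + a)
      + ((N : ℂ) + a) * Complex.log ((N : ℂ) + a) - ((N : ℂ) + a) := by
  rw [(hasDerivAt_GN ha N zero_ne_one).deriv]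
  simp
  ring

lemma key_identity {a : ℂ} (ha : 0 < a.re) {N : ℕ} (hN : N ≠ 0) :
    Complex.exp (-(deriv (GN a N) 0)) * Complex.GammaSeq a N =
      (Stirling.stirlingSeq N : ℂ) * (Real.sqrt 2 : ℂ) *
        Complex.exp (a - ((N : ℂ) * Complex.log (1 + a / N)
          + (a + 1 / 2) * Complex.log (1 + a / N))) := by
  have hNr : (0 : ℝ) < N := by positivity
  have hNc : (N : ℂ) ≠ 0 := by exact_mod_cast hN
  have h1 : (1 + a / N : ℂ) ≠ 0 := by
    have := ne_zero_na ha N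
    intro h
    apply this
    field_simp at h
    simpa using h
  have hlog : Complex.log ((N : ℂ) + a) = Complex.log N + Complex.log (1 + a / N) := by
    have e : (N : ℂ) + a = ((N : ℝ) : ℂ) * (1 + a / N) := by
      push_cast; field_simp
    rw [e, Complex.log_ofReal_mul hNr h1, Complex.natCast_log]
  have hp : ∏ k ∈ Finset.range N, (a + (k : ℂ)) ≠ 0 :=
    Finset.prod_ne_zero_iff.mpr fun k _ => by rw [add_comm]; exact ne_zero_na ha k
  have hsum : Complex.exp (∑ k ∈ Finset.range N, Complex.log ((k : ℂ) + a))
      = ∏ k ∈ Finset.range N, (a + (k : ℂ)) := by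
    rw [Complex.exp_sum]
    refine Finset.prod_congr rfl fun k _ => ?_
    rw [Complex.exp_log (ne_zero_na ha k), add_comm]
  have hfac : (N.factorial : ℂ) = (Stirling.stirlingSeq N : ℂ) * (Real.sqrt 2 : ℂ)
      * Complex.exp ((1 / 2) * Complex.log N + N * Complex.log N - N) := by
    have hr : (N.factorial : ℝ) = Stirling.stirlingSeq N * Real.sqrt 2
      * Real.exp ((1 / 2) * Real.log N + N * Real.log N - N) := by
      have e1 : Real.exp ((1 / 2) * Real.log N + N * Real.log N - N)
          = Real.sqrt N * (N / Real.exp 1) ^ N := by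
        rw [Real.exp_sub, Real.exp_add, Real.sqrt_eq_rpow, Real.rpow_def_of_pos hNr, div_pow,
          ← Real.exp_nat_mul 1, Real.exp_nat_mul, Real.exp_log hNr, mul_comm (1 / 2 : ℝ)]
        simp [mul_div_assoc]
      rw [e1, Stirling.stirlingSeq, Real.sqrt_mul (by norm_num)]
      have : Real.sqrt N ≠ 0 := (Real.sqrt_pos.mpr hNr).ne'
      field_simp
    have := congrArg (fun r : ℝ => (r : ℂ)) hr
    simpa [Complex.natCast_log] using this
  have hA : Complex.exp (-(deriv (GN a N) 0)) =
      (∏ k ∈ Finset.range N, (a + (k : ℂ))) * Complex.exp ((1 / 2) * Complex.log ((N : ℂ) + a)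
      - ((N : ℂ) + a) * Complex.log ((N : ℂ) + a) + ((N : ℂ) + a)) := by
    rw [← hsum, ← Complex.exp_add, deriv_GN_zero ha]
    congr 1; ring
  have hNa : a + (N : ℂ) = Complex.exp (Complex.log ((N : ℂ) + a)) := by
    rw [Complex.exp_log (ne_zero_na ha N), add_comm]
  rw [hA, Complex.GammaSeq, Finset.prod_range_succ, hfac, Complex.cpow_def_of_ne_zero hNc]
  have : ∀ P E1 E2 S E3 : ℂ, P ≠ 0 → P * E1 * (E2 * (S * E3) / (P * (a + (N : ℂ))))
      = S * (E1 * E2 * E3 * (a + (N : ℂ))⁻¹) := by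
    intro P E1 E2 S E3 hP
    field_simp
  rw [this _ _ _ _ _ hp, hNa, ← Complex.exp_neg, ← Complex.exp_add, ← Complex.exp_add,
    ← Complex.exp_add, hlog]
  congr 2
  ring

lemma GG_exp {a : ℂ} (ha : 0 < a.re) :
    Complex.exp (-(deriv (GG a) 0)) * Complex.Gamma a = (Real.sqrt (2 * Real.pi) : ℂ) := by
  have h0 := GG_deriv_tendsto ha zero_mem_UU
  have h1 : Tendsto (fun N => Complex.exp (-(deriv (GN a N) 0)) * Complex.GammaSeq a N) atTop
      (𝓝 (Complex.exp (-(deriv (GG a) 0)) * Complex.Gamma a)) := by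
    refine Tendsto.mul ?_ (Complex.GammaSeq_tendsto_Gamma a)
    refine (Complex.continuous_exp.tendsto _).comp ?_
    exact ((tendsto_add_atTop_iff_nat (f := fun N => deriv (GN a N) 0) 1).mp h0).neg
  refine tendsto_nhds_unique h1 ?_
  have hl : Tendsto (fun n : ℕ => (n : ℂ) * Complex.log (1 + a / n)) atTop (𝓝 a) := by
    refine Complex.tendsto_nat_mul_log_one_add_of_tendsto ?_
    refine tendsto_const_nhds.congr' ?_
    filter_upwards [eventually_ne_atTop 0] with n hn
    have : (n : ℂ) ≠ 0 := by exact_mod_cast hn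
    field_simp
  have hl0 : Tendsto (fun n : ℕ => Complex.log (1 + a / n)) atTop (𝓝 0) := by
    have : Tendsto (fun n : ℕ => 1 + a / (n : ℂ)) atTop (𝓝 1) := by
      simpa using (tendsto_const_div_atTop_nhds_zero_nat a).const_add 1
    have h := this.clog (by simp)
    simpa using h
  have hexp := (Complex.continuous_exp.tendsto _).comp
    ((hl.add (hl0.const_mul (a + 1 / 2))).const_sub a)
  have hst : Tendsto (fun N => (Stirling.stirlingSeq N : ℂ)) atTop (𝓝 (Real.sqrt Real.pi : ℂ)) :=
    (Complex.continuous_ofReal.tendsto _).comp Stirling.tendsto_stirlingSeq_sqrt_pi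
  have := (hst.mul_const (Real.sqrt 2 : ℂ)).mul hexp
  have e : (Real.sqrt (2 * Real.pi) : ℂ)
      = (Real.sqrt Real.pi : ℂ) * (Real.sqrt 2 : ℂ) * Complex.exp (a - (a + (a + 1 / 2) * 0)) := by
    rw [Real.sqrt_mul (by norm_num)]
    simp [mul_comm]
  rw [e]
  refine this.congr' ?_
  filter_upwards [eventually_ne_atTop 0] with N hN
  exact (key_identity ha hN).symm

lemma two_mul_cpow {y : ℂ} (hy : y ≠ 0) (w : ℂ) :
    (2 * y) ^ (-w) = (2 : ℂ) ^ (-w) * y ^ (-w) := by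
  have h : Complex.log (2 * y) = Complex.log 2 + Complex.log y := by
    have := Complex.log_ofReal_mul (r := 2) (by norm_num) hy
    rw [Complex.ofReal_log (by norm_num)] at this
    simpa using this
  rw [Complex.cpow_def_of_ne_zero (mul_ne_zero two_ne_zero hy), h,
    Complex.cpow_def_of_ne_zero two_ne_zero, Complex.cpow_def_of_ne_zero hy, ← Complex.exp_add]
  congr 1; ring

lemma tsum_scale {a : ℂ} (ha : 0 < a.re) {w : ℂ} (hw : w ∈ UU) (hw1 : 1 < w.re)
    {f : ℕ → ℂ} (hf : ∀ k : ℕ, f k = 2 * ((k : ℂ) + a)) :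
    ∑' k : ℕ, f k ^ (-w) = (2 : ℂ) ^ (-w) * GG a w := by
  rw [GG_eq ha hw hw1, ← tsum_mul_left]
  refine tsum_congr fun k => ?_
  rw [hf, two_mul_cpow (ne_zero_na ha k)]

lemma hasDerivAt_scaled {a : ℂ} (ha : 0 < a.re) :
    HasDerivAt (fun w => (2 : ℂ) ^ (-w) * GG a w)
      (-Complex.log 2 * (1 / 2 - a) + deriv (GG a) 0) 0 := by
  have h1 : HasDerivAt (fun w : ℂ => (2 : ℂ) ^ (-w))
      ((2 : ℂ) ^ (-(0 : ℂ)) * Complex.log 2 * (-1)) 0 :=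
    (hasDerivAt_neg (0 : ℂ)).const_cpow (Or.inl two_ne_zero)
  have h2 := ((GG_diffOn ha).differentiableAt (UU_open.mem_nhds zero_mem_UU)).hasDerivAt
  refine (h1.mul h2).congr_deriv ?_
  rw [GG_zero ha]; simp

lemma exp_scaled {a : ℂ} (ha : 0 < a.re) :
    Complex.exp (-(-Complex.log 2 * (1 / 2 - a) + deriv (GG a) 0)) =
      Complex.exp (Complex.log 2 * (1 / 2 - a)) * (Real.sqrt (2 * Real.pi) : ℂ)
        / Complex.Gamma a := by
  have hG : Complex.Gamma a ≠ 0 := Complex.Gamma_ne_zero_of_re_pos ha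
  rw [← GG_exp ha, eq_div_iff hG, ← mul_assoc, ← Complex.exp_add]
  congr 2; ring

lemma hasDerivAt_cpow_neg {y : ℂ} (hy : y ≠ 0) :
    HasDerivAt (fun w : ℂ => y ^ (-w)) (-Complex.log y) 0 := by
  have := (hasDerivAt_neg (0 : ℂ)).const_cpow (c := y) (Or.inl hy)
  simpa using this

lemma log_two_pi : Complex.log (2 * Real.pi : ℂ) = Complex.log 2 + Complex.log Real.pi := by
  have := Complex.log_ofReal_mul (r := 2) (x := (Real.pi : ℂ)) (by norm_num)
    (by exact_mod_cast Real.pi_ne_zero)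
  rw [Complex.ofReal_log (by norm_num)] at this
  simpa using this

lemma log_sqrt_two_pi : Complex.log (Real.sqrt (2 * Real.pi) : ℂ)
    = (Complex.log 2 + Complex.log Real.pi) / 2 := by
  rw [← log_two_pi, ← Complex.ofReal_log (Real.sqrt_nonneg _), Real.log_sqrt (by positivity)]
  have : (2 * Real.pi : ℂ) = ((2 * Real.pi : ℝ) : ℂ) := by push_cast; rfl
  rw [this, ← Complex.ofReal_log (by positivity)]
  push_cast; rfl

lemma sqrt_exp {x : ℝ} (hx : 0 < x) : (Real.sqrt x : ℂ) = Complex.exp (Complex.log x / 2) := by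
  rw [Real.sqrt_eq_rpow, Real.rpow_def_of_pos hx, ← Complex.ofReal_log hx.le]
  push_cast
  congr 1; ring

lemma two_exp : (2 : ℂ) = Complex.exp (Complex.log 2) := (Complex.exp_log two_ne_zero).symm

lemma factor_one {s : ℂ} (hs : 0 < s.re) :
    Complex.exp (Complex.log 2 * (1 / 2 - (s / 2 + 1))) * (Real.sqrt (2 * Real.pi) : ℂ)
        / Complex.Gamma (s / 2 + 1)
      = s⁻¹ * ((GammaR s)⁻¹ * ((Real.sqrt (2 * Real.pi) : ℂ) ^ s)⁻¹
          * (2 * Real.sqrt Real.pi : ℂ)) := by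
  have hs0 : s ≠ 0 := by rintro rfl; simp at hs
  have hG : Complex.Gamma (s / 2) ≠ 0 := Complex.Gamma_ne_zero_of_re_pos (by simp; linarith)
  have hpi : (Real.pi : ℂ) ≠ 0 := by exact_mod_cast Real.pi_ne_zero
  have hq : (Real.sqrt (2 * Real.pi) : ℂ) ≠ 0 := by
    exact_mod_cast (Real.sqrt_pos.mpr (by positivity)).ne'
  rw [Complex.Gamma_add_one _ (by simpa using hs0), GammaR, Complex.cpow_def_of_ne_zero hpi,
    Complex.cpow_def_of_ne_zero hq, log_sqrt_two_pi]
  have key : Complex.exp (Complex.log 2 * (1 / 2 - (s / 2 + 1)))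
      * (Real.sqrt (2 * Real.pi) : ℂ) * 2
      = (Complex.exp (Complex.log Real.pi * -(s / 2)))⁻¹
        * (Complex.exp ((Complex.log 2 + Complex.log Real.pi) / 2 * s))⁻¹
        * (2 * Real.sqrt Real.pi : ℂ) := by
    rw [sqrt_exp (by positivity), sqrt_exp Real.pi_pos]
    push_cast
    rw [log_two_pi, ← Complex.exp_neg, ← Complex.exp_neg]
    conv_lhs => rw [mul_comm]
    rw [← Complex.exp_add, ← Complex.exp_add, mul_left_comm, ← Complex.exp_add]
    congr 2; ring
  rw [div_eq_iff (mul_ne_zero (div_ne_zero hs0 two_ne_zero) hG)]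
  rw [mul_inv, mul_assoc (Complex.Gamma (s / 2))⁻¹, mul_assoc (Complex.Gamma (s / 2))⁻¹, ← key]
  field_simp

lemma factor_two {s : ℂ} (hs : 0 < s.re) :
    ((GammaR s)⁻¹ * ((Real.sqrt (2 * Real.pi) : ℂ) ^ s)⁻¹ * (2 * Real.sqrt Real.pi : ℂ)) *
    (Complex.exp (Complex.log 2 * (1 / 2 - (s / 2 + 1 / 2))) * (Real.sqrt (2 * Real.pi) : ℂ)
        / Complex.Gamma (s / 2 + 1 / 2))
      = (GammaC s)⁻¹ * ((Real.sqrt (2 * Real.pi) : ℂ) ^ (2 * s))⁻¹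
          * (2 * Real.sqrt (2 * Real.pi) : ℂ) := by
  have hG : Complex.Gamma (s / 2) ≠ 0 := Complex.Gamma_ne_zero_of_re_pos (by simp; linarith)
  have hG2 : Complex.Gamma (s / 2 + 1 / 2) ≠ 0 :=
    Complex.Gamma_ne_zero_of_re_pos (by simp; linarith)
  have hG3 : Complex.Gamma s ≠ 0 := Complex.Gamma_ne_zero_of_re_pos hs
  have hpi : (Real.pi : ℂ) ≠ 0 := by exact_mod_cast Real.pi_ne_zero
  have hq : (Real.sqrt (2 * Real.pi) : ℂ) ≠ 0 := by
    exact_mod_cast (Real.sqrt_pos.mpr (by positivity)).ne'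
  have hp : (Real.sqrt Real.pi : ℂ) ≠ 0 := by
    exact_mod_cast (Real.sqrt_pos.mpr Real.pi_pos).ne'
  have dup := Complex.Gamma_mul_Gamma_add_half (s / 2)
  rw [mul_div_cancel₀ s two_ne_zero, Complex.cpow_def_of_ne_zero two_ne_zero] at dup
  have hG2' : Complex.Gamma (s / 2 + 1 / 2)
      = Complex.Gamma s * Complex.exp (Complex.log 2 * (1 - s)) * (Real.sqrt Real.pi : ℂ)
        / Complex.Gamma (s / 2) := by
    rw [eq_div_iff hG, mul_comm, dup]
  rw [hG2', GammaR, GammaC, Complex.cpow_def_of_ne_zero hpi,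
    Complex.cpow_def_of_ne_zero hq, Complex.cpow_def_of_ne_zero hq, log_sqrt_two_pi,
    Complex.cpow_def_of_ne_zero (mul_ne_zero two_ne_zero hpi), log_two_pi]
  have key : (Complex.exp (Complex.log Real.pi * -(s / 2)))⁻¹
      * (Complex.exp ((Complex.log 2 + Complex.log Real.pi) / 2 * s))⁻¹ * 2
      * Complex.exp (Complex.log 2 * (1 / 2 - (s / 2 + 1 / 2)))
      * (Complex.exp (Complex.log 2 * (1 - s)))⁻¹
      = (Complex.exp ((Complex.log 2 + Complex.log Real.pi) * -s))⁻¹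
        * (Complex.exp ((Complex.log 2 + Complex.log Real.pi) / 2 * (2 * s)))⁻¹ := by
    have h : ∀ A B D E : ℂ, A * B * 2 * D * E = Complex.exp (Complex.log 2) * A * B * D * E := by
      intro A B D E
      rw [← two_exp]; ring
    rw [h]
    simp only [← Complex.exp_neg, ← Complex.exp_add]
    congr 1; ring
  have e : ∀ p q g h A B D E X Y : ℂ, g ≠ 0 → h ≠ 0 → p ≠ 0 →
      A⁻¹ * B⁻¹ * 2 * D * E⁻¹ = X⁻¹ * Y⁻¹ →
      (g * A)⁻¹ * B⁻¹ * (2 * p) * (D * q / (h * E * p / g))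
        = (2 * X * h)⁻¹ * Y⁻¹ * (2 * q) := by
    intro p q g h A B D E X Y hg hh hp hk
    have : (2 * X * h)⁻¹ * Y⁻¹ * (2 * q) = (X⁻¹ * Y⁻¹) * (h⁻¹ * q) := by
      simp only [mul_inv]; ring
    rw [this, ← hk]
    simp only [mul_inv, div_eq_mul_inv, inv_inv]
    field_simp
  exact e _ _ _ _ _ _ _ _ _ _ hG hG3 hp key

end RiemannDet

/-- Main theorem: the zeta regularized determinant of the Riemann operator,
`det((sI − 𝓡) | ⊕ₙ Kₙ(A)_ℂ)
  = (s − 1/2)·s⁻¹·(Γ_ℝ(s)^{r₁}·Γ_ℂ(s)^{r₂}·(√(2π))^{(r₁+2r₂)s})⁻¹·(2√π)^{r₁}·(2√(2π))^{r₂}`,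
where the left-hand side is `exp(−F′(0))` for `F` the analytic continuation of
`w ↦ (s−1/2)^(−w) + (r₁+r₂−1)·s^(−w) + (r₁+r₂)·∑_{k=1}^∞ (2k+s)^(−w)
  + r₂·∑_{k=0}^∞ (2k+1+s)^(−w)` (Borel's computation of `φ_A(w,s)`). -/
theorem riemann_operator_det (r₁ r₂ : ℕ) (hr : 1 ≤ r₁ + r₂) (s : ℂ) (hs : 1 / 2 < s.re)
    (F : ℂ → ℂ)
    (hF : ∀ w : ℂ, w ≠ 1 → DifferentiableAt ℂ F w)
    (hFeq : ∀ w : ℂ, 1 < w.re →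
      F w = (s - 1 / 2) ^ (-w) + ((r₁ + r₂ - 1 : ℕ) : ℂ) * s ^ (-w)
        + ((r₁ + r₂ : ℕ) : ℂ) * ∑' k : ℕ, (2 * ((k : ℂ) + 1) + s) ^ (-w)
        + (r₂ : ℂ) * ∑' k : ℕ, (2 * (k : ℂ) + 1 + s) ^ (-w)) :
    Complex.exp (-(deriv F 0)) =
      (s - 1 / 2) * s⁻¹
        * (GammaR s ^ r₁ * GammaC s ^ r₂
            * (Real.sqrt (2 * Real.pi) : ℂ) ^ (((r₁ : ℂ) + 2 * r₂) * s))⁻¹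
        * (2 * Real.sqrt Real.pi : ℂ) ^ r₁ * (2 * Real.sqrt (2 * Real.pi) : ℂ) ^ r₂ := by
  have hs0 : s ≠ 0 := by rintro rfl; simp at hs; linarith
  have hsr : 0 < s.re := by linarith
  have hs1 : s - 1 / 2 ≠ 0 := by
    intro h
    have := congrArg Complex.re h
    simp at this
    norm_num at hs
    linarith
  have ha1 : 0 < (s / 2 + 1).re := by simp; linarith
  have ha2 : 0 < (s / 2 + 1 / 2).re := by simp; linarith
  set H : ℂ → ℂ := fun w => (s - 1 / 2) ^ (-w) + ((r₁ + r₂ - 1 : ℕ) : ℂ) * s ^ (-w)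
        + ((r₁ + r₂ : ℕ) : ℂ) * ((2 : ℂ) ^ (-w) * RiemannDet.GG (s / 2 + 1) w)
        + (r₂ : ℂ) * ((2 : ℂ) ^ (-w) * RiemannDet.GG (s / 2 + 1 / 2) w) with hH
  have hHd : DifferentiableOn ℂ H RiemannDet.UU := by
    have hc : ∀ y : ℂ, y ≠ 0 → DifferentiableOn ℂ (fun w : ℂ => y ^ (-w)) RiemannDet.UU :=
      fun y hy w _ => ((hasDerivAt_neg w).const_cpow
        (Or.inl hy)).differentiableAt.differentiableWithinAt
    exact (((hc _ hs1).add ((hc _ hs0).const_mul _)).add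
      (((hc _ two_ne_zero).mul (RiemannDet.GG_diffOn ha1)).const_mul _)).add
      (((hc _ two_ne_zero).mul (RiemannDet.GG_diffOn ha2)).const_mul _)
  have hFd : DifferentiableOn ℂ F RiemannDet.UU := fun w hw =>
    (hF w (RiemannDet.ne_one_of_mem hw)).differentiableWithinAt
  have hEq : Set.EqOn F H RiemannDet.UU := by
    refine (hFd.analyticOnNhd RiemannDet.UU_open).eqOn_of_preconnected_of_eventuallyEq
      (hHd.analyticOnNhd RiemannDet.UU_open) RiemannDet.UU_convex.isPreconnected
      RiemannDet.pt_mem_UU ?_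
    have hre : IsOpen {w : ℂ | 1 < w.re} := isOpen_lt continuous_const Complex.continuous_re
    filter_upwards [RiemannDet.UU_open.mem_nhds RiemannDet.pt_mem_UU,
      hre.mem_nhds (show (2 + 2 * Complex.I : ℂ) ∈ {w : ℂ | 1 < w.re} by simp)] with w hw hw1
    rw [hFeq w hw1, RiemannDet.tsum_scale ha1 hw hw1 (fun k => by ring),
      RiemannDet.tsum_scale ha2 hw hw1 (fun k => by ring)]
  have hder : deriv F 0 = deriv H 0 := Filter.EventuallyEq.deriv_eq
    (hEq.eventuallyEq_of_mem (RiemannDet.UU_open.mem_nhds RiemannDet.zero_mem_UU))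
  have hH0 := (((RiemannDet.hasDerivAt_cpow_neg hs1).add
    ((RiemannDet.hasDerivAt_cpow_neg hs0).const_mul ((r₁ + r₂ - 1 : ℕ) : ℂ))).add
      ((RiemannDet.hasDerivAt_scaled ha1).const_mul ((r₁ + r₂ : ℕ) : ℂ))).add
      ((RiemannDet.hasDerivAt_scaled ha2).const_mul (r₂ : ℂ))
  have hH1 : deriv H 0 = _ := hH0.deriv
  rw [hder, hH1]
  have hexp : ∀ (A B C D : ℂ) (m n p : ℕ),
      Complex.exp (-(-A + (m : ℂ) * -B + (n : ℂ) * C + (p : ℂ) * D))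
      = Complex.exp A * Complex.exp B ^ m * Complex.exp (-C) ^ n * Complex.exp (-D) ^ p := by
    intro A B C D m n p
    rw [← Complex.exp_nat_mul, ← Complex.exp_nat_mul, ← Complex.exp_nat_mul, ← Complex.exp_add,
      ← Complex.exp_add, ← Complex.exp_add]
    congr 1; ring
  rw [hexp, Complex.exp_log hs1, Complex.exp_log hs0, RiemannDet.exp_scaled ha1,
    RiemannDet.exp_scaled ha2, RiemannDet.factor_one hsr]
  have h2 := RiemannDet.factor_two hsr
  have hq : (Real.sqrt (2 * Real.pi) : ℂ) ≠ 0 := by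
    exact_mod_cast (Real.sqrt_pos.mpr (by positivity)).ne'
  have hpow : (Real.sqrt (2 * Real.pi) : ℂ) ^ (((r₁ : ℂ) + 2 * r₂) * s)
      = ((Real.sqrt (2 * Real.pi) : ℂ) ^ s) ^ r₁ * ((Real.sqrt (2 * Real.pi) : ℂ) ^ (2 * s)) ^ r₂ := by
    rw [← Complex.cpow_nat_mul, ← Complex.cpow_nat_mul, ← Complex.cpow_add _ _ hq]
    congr 1; ring
  rw [hpow]
  have hsm : s ^ (r₁ + r₂ - 1) * s⁻¹ ^ (r₁ + r₂) = s⁻¹ := by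
    obtain ⟨m, hm⟩ : ∃ m, r₁ + r₂ = m + 1 := ⟨r₁ + r₂ - 1, by omega⟩
    rw [hm, Nat.add_sub_cancel, pow_succ, ← mul_assoc, ← mul_pow, mul_inv_cancel₀ hs0]
    simp
  generalize (Complex.exp (Complex.log 2 * (1 / 2 - (s / 2 + 1 / 2)))
    * (Real.sqrt (2 * Real.pi) : ℂ) / Complex.Gamma (s / 2 + 1 / 2)) = X at h2 ⊢
  generalize hY : (GammaR s)⁻¹ * ((Real.sqrt (2 * Real.pi) : ℂ) ^ s)⁻¹
    * (2 * Real.sqrt Real.pi : ℂ) = Y at h2 ⊢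
  calc (s - 1 / 2) * s ^ (r₁ + r₂ - 1) * (s⁻¹ * Y) ^ (r₁ + r₂) * X ^ r₂
      = (s - 1 / 2) * (s ^ (r₁ + r₂ - 1) * s⁻¹ ^ (r₁ + r₂)) * Y ^ r₁ * (Y * X) ^ r₂ := by
        rw [mul_pow, pow_add Y, mul_pow]; ring
    _ = _ := by
        rw [hsm, h2, ← hY]
        simp only [mul_pow, mul_inv, inv_pow]
        ring
end

section
/- Let s be a complex number with Re(s) > 0. Suppose F : ℂ → ℂ is complex-differentiable at every point w ≠ 1 and satisfies F(w) = ∑_{k=1}^∞ (2k + s)^(−w) for all w with Re(w) > 1 (principal-branch powers). Then exp(−F′(0)) = s^(−1) · Γ_ℝ(s)^(−1) · (√(2π))^(−s) · 2√π. -/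
open Filter Topology

noncomputable def hTerm (s : ℂ) (k : ℕ) (w : ℂ) : ℂ :=
  (2 * ((k : ℂ) + 1) + s) ^ (-w) - (2 * ((k : ℂ) + 1)) ^ (-w)
    + s * w * (2 * ((k : ℂ) + 1)) ^ (-w - 1)

def regU : Set ℂ := {w : ℂ | -(1/2) < w.re ∧ ‖w‖ < 3 ∧ w.re - 1 < w.im}

lemma isOpen_regU : IsOpen regU := by
  have h1 : IsOpen {w : ℂ | -(1/2) < w.re} := isOpen_lt (by fun_prop) (by fun_prop)
  have h2 : IsOpen {w : ℂ | ‖w‖ < 3} := isOpen_lt (by fun_prop) (by fun_prop)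
  have h3 : IsOpen {w : ℂ | w.re - 1 < w.im} := isOpen_lt (by fun_prop) (by fun_prop)
  exact h1.inter (h2.inter h3)

lemma convex_regU : Convex ℝ regU := by
  intro x hx y hy a b ha hb hab
  obtain ⟨h1, h2, h3⟩ := hx
  obtain ⟨g1, g2, g3⟩ := hy
  refine ⟨?_, ?_, ?_⟩
  · have := (convex_halfSpace_re_gt (-(1/2))) h1 g1 ha hb hab
    exact this
  · have := (convex_ball (0:ℂ) 3) (x := x) (by simpa using h2) (y := y) (by simpa using g2) ha hb hab
    simpa using this
  · simp only [Complex.add_re, Complex.add_im, Complex.real_smul, Complex.mul_re, Complex.mul_im,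
      Complex.ofReal_re, Complex.ofReal_im]
    rcases eq_or_lt_of_le ha with h | h
    · subst h
      have : b = 1 := by linarith
      subst this; linarith
    · nlinarith [mul_pos h (sub_pos.2 h3), mul_nonneg hb (sub_pos.2 g3).le]

lemma base_re (s : ℂ) (hs : 0 < s.re) (k : ℕ) : 0 < (2 * ((k : ℂ) + 1) + s).re := by
  simp; positivity

lemma base_re0 (k : ℕ) : 0 < (2 * ((k : ℂ) + 1)).re := by
  simp; positivity

lemma ne_zero_of_re {z : ℂ} (h : 0 < z.re) : z ≠ 0 := by
  rintro rfl; simp at h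

lemma hTerm_hasDerivAt (s : ℂ) (hs : 0 < s.re) (k : ℕ) :
    HasDerivAt (hTerm s k) (-Complex.log (2 * ((k : ℂ) + 1) + s) + Complex.log (2 * ((k : ℂ) + 1))
      + s / (2 * ((k : ℂ) + 1))) 0 := by
  have h1 := ne_zero_of_re (base_re s hs k)
  have h0 := ne_zero_of_re (base_re0 k)
  have e1 := (hasDerivAt_neg (0:ℂ)).const_cpow (c := 2 * ((k : ℂ) + 1) + s) (Or.inl h1)
  have e0 := (hasDerivAt_neg (0:ℂ)).const_cpow (c := 2 * ((k : ℂ) + 1)) (Or.inl h0)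
  have e2 := ((hasDerivAt_neg (0:ℂ)).sub_const 1).const_cpow (c := 2 * ((k : ℂ) + 1)) (Or.inl h0)
  have e3 := ((hasDerivAt_id (0:ℂ)).const_mul s).mul e2
  refine ((e1.sub e0).add e3).congr_deriv ?_
  simp [Complex.cpow_neg_one]
  field_simp

lemma hTerm_differentiable (s : ℂ) (hs : 0 < s.re) (k : ℕ) :
    Differentiable ℂ (hTerm s k) := by
  have h1 := ne_zero_of_re (base_re s hs k)
  have h0 := ne_zero_of_re (base_re0 k)
  intro w
  unfold hTerm
  refine ((DifferentiableAt.const_cpow (by fun_prop) (Or.inl h1)).sub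
    (DifferentiableAt.const_cpow (by fun_prop) (Or.inl h0))).add
    (DifferentiableAt.mul (by fun_prop) (DifferentiableAt.const_cpow (by fun_prop) (Or.inl h0)))

lemma crude_cpow {c : ℂ} (hc : c ≠ 0) (w : ℂ) (R : ℝ) (hw : ‖w‖ ≤ R) :
    ‖c ^ w‖ ≤ Real.exp (R * ‖Complex.log c‖) := by
  rw [Complex.cpow_def_of_ne_zero hc]
  refine (Complex.norm_exp_le_exp_norm _).trans ?_
  rw [norm_mul, mul_comm]
  gcongr

lemma hTerm_crude (s : ℂ) (hs : 0 < s.re) (k : ℕ) : ∃ C : ℝ, ∀ w ∈ regU, ‖hTerm s k w‖ ≤ C := by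
  have h1 := ne_zero_of_re (base_re s hs k)
  have h0 := ne_zero_of_re (base_re0 k)
  refine ⟨Real.exp (4 * ‖Complex.log (2 * ((k : ℂ) + 1) + s)‖)
    + Real.exp (4 * ‖Complex.log (2 * ((k : ℂ) + 1))‖)
    + ‖s‖ * 3 * Real.exp (4 * ‖Complex.log (2 * ((k : ℂ) + 1))‖), ?_⟩
  rintro w ⟨-, hw, -⟩
  unfold hTerm
  refine (norm_add_le _ _).trans (add_le_add ((norm_sub_le _ _).trans (add_le_add ?_ ?_)) ?_)
  · exact crude_cpow h1 _ _ (by rw [norm_neg]; linarith)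
  · exact crude_cpow h0 _ _ (by rw [norm_neg]; linarith)
  · rw [norm_mul, norm_mul]
    gcongr
    refine crude_cpow h0 _ _ ((norm_sub_le _ _).trans ?_)
    rw [norm_neg, norm_one]; linarith

lemma hTerm_fine (s : ℂ) (hs : 0 < s.re) (k : ℕ) (hk : 3 * ‖s‖ ≤ k) (w : ℂ) (hw : w ∈ regU) :
    ‖hTerm s k w‖ ≤ 23 * ‖s‖ ^ 2 * (((k + 1 : ℕ) : ℝ) ^ (3/2 : ℝ))⁻¹ := by
  obtain ⟨hw1, hw2, -⟩ := hw
  have h1 := ne_zero_of_re (base_re s hs k)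
  have h0 := ne_zero_of_re (base_re0 k)
  obtain ⟨M, hM⟩ : ∃ M : ℝ, M = 2 * ((k : ℝ) + 1) := ⟨_, rfl⟩
  have hMp : 0 < M := by rw [hM]; positivity
  have hM1 : 1 ≤ M := by rw [hM]; have : (0:ℝ) ≤ k := by positivity
                         linarith
  have hMc : 2 * ((k : ℂ) + 1) = (M : ℂ) := by rw [hM]; push_cast; ring
  have hMc0 : (M : ℂ) ≠ 0 := by exact_mod_cast hMp.ne'
  unfold hTerm
  rw [hMc] at h1 h0 ⊢
  obtain ⟨z, hz⟩ : ∃ z : ℂ, z = s / M := ⟨_, rfl⟩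
  have hs' : s = M * z := by rw [hz]; field_simp
  have hz6 : ‖z‖ ≤ 1 / 6 := by
    rw [hz, norm_div, Complex.norm_real, Real.norm_of_nonneg hMp.le, div_le_iff₀ hMp, hM]
    linarith
  have hzn : ‖z‖ = ‖s‖ / M := by
    rw [hz, norm_div, Complex.norm_real, Real.norm_of_nonneg hMp.le]
  have h1z : 1 + z ≠ 0 := by
    intro h
    apply h1
    rw [hs', ← mul_one_add, h, mul_zero]
  obtain ⟨u, hu⟩ : ∃ u : ℂ, u = -w * Complex.log (1 + z) := ⟨_, rfl⟩
  have e1 : ((M : ℂ) + s) ^ (-w) = (M : ℂ) ^ (-w) * Complex.exp u := by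
    rw [Complex.cpow_def_of_ne_zero h1, Complex.cpow_def_of_ne_zero hMc0, ← Complex.exp_add, hu]
    have : (M : ℂ) + s = M * (1 + z) := by rw [hs']; ring
    rw [this, Complex.log_ofReal_mul hMp h1z, Complex.ofReal_log hMp.le]
    ring_nf
  have e2 : (M : ℂ) ^ (-w - 1) = (M : ℂ) ^ (-w) / M := by
    rw [Complex.cpow_sub _ _ hMc0, Complex.cpow_one]
  have e3 : ((M : ℂ) + s) ^ (-w) - (M : ℂ) ^ (-w) + s * w * (M : ℂ) ^ (-w - 1)
      = (M : ℂ) ^ (-w) * ((Complex.exp u - 1 - u) - w * (Complex.log (1 + z) - z)) := by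
    rw [e1, e2, hu, hz]; field_simp; ring
  have hz0 := norm_nonneg z
  have hun : ‖u‖ ≤ 9 / 2 * ‖z‖ := by
    rw [hu, norm_mul, norm_neg]
    have := Complex.norm_log_one_add_half_le_self (z := z) (by linarith)
    calc ‖w‖ * ‖Complex.log (1 + z)‖ ≤ 3 * (3 / 2 * ‖z‖) := by gcongr
      _ = _ := by ring
  have b1 : ‖Complex.exp u - 1 - u‖ ≤ (9 / 2 * ‖z‖) ^ 2 :=
    (Complex.norm_exp_sub_one_sub_id_le (by linarith)).trans (by gcongr)
  have b2 : ‖Complex.log (1 + z) - z‖ ≤ ‖z‖ ^ 2 * (6 / 5) / 2 := by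
    refine (Complex.norm_log_one_add_sub_self_le (by linarith)).trans ?_
    gcongr
    rw [inv_le_comm₀ (by linarith) (by norm_num)]
    linarith
  have b3 : ‖(Complex.exp u - 1 - u) - w * (Complex.log (1 + z) - z)‖ ≤ 23 * ‖z‖ ^ 2 := by
    refine (norm_sub_le _ _).trans ?_
    rw [norm_mul]
    calc _ ≤ (9 / 2 * ‖z‖) ^ 2 + 3 * (‖z‖ ^ 2 * (6 / 5) / 2) := by gcongr
      _ ≤ _ := by nlinarith [sq_nonneg ‖z‖]
  rw [e3, norm_mul, Complex.norm_cpow_eq_rpow_re_of_pos hMp]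
  have b4 : M ^ (-w).re ≤ M ^ (1/2 : ℝ) :=
    Real.rpow_le_rpow_of_exponent_le hM1 (by rw [Complex.neg_re]; linarith)
  calc _ ≤ M ^ (1/2 : ℝ) * (23 * ‖z‖ ^ 2) := by gcongr
    _ = 23 * ‖s‖ ^ 2 * (M ^ (3/2 : ℝ))⁻¹ := by
      have : M ^ (3/2 : ℝ) * M ^ (1/2 : ℝ) = M ^ 2 := by
        rw [← Real.rpow_add hMp]; norm_num
      have p1 : 0 < M ^ (3/2 : ℝ) := by positivity
      rw [hzn, div_pow, ← this]
      field_simp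
    _ ≤ _ := by
      gcongr
      rw [hM]; push_cast
      have : (0:ℝ) ≤ k := by positivity
      linarith

lemma hTerm_bound (s : ℂ) (hs : 0 < s.re) :
    ∃ u : ℕ → ℝ, Summable u ∧ ∀ k, ∀ w ∈ regU, ‖hTerm s k w‖ ≤ u k := by
  choose C hC using hTerm_crude s hs
  classical
  refine ⟨fun k => if 3 * ‖s‖ ≤ k then 23 * ‖s‖ ^ 2 * (((k + 1 : ℕ) : ℝ) ^ (3/2 : ℝ))⁻¹ else C k,
    ?_, ?_⟩
  · have h : Summable fun k : ℕ => 23 * ‖s‖ ^ 2 * (((k + 1 : ℕ) : ℝ) ^ (3/2 : ℝ))⁻¹ :=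
      ((summable_nat_add_iff 1).2
        (Real.summable_nat_rpow_inv.2 (by norm_num : (1:ℝ) < 3/2))).mul_left _
    refine (summable_congr_atTop ?_).2 h
    filter_upwards [eventually_ge_atTop ⌈3 * ‖s‖⌉₊] with k hk
    rw [if_pos (Nat.ceil_le.1 hk)]
  · intro k w hw
    dsimp only
    split_ifs with h
    · exact hTerm_fine s hs k h w hw
    · exact hC k w hw

lemma two_cpow_sum (w : ℂ) (hw : 1 < w.re) :
    HasSum (fun k : ℕ => (2 * ((k : ℂ) + 1)) ^ (-w)) (2 ^ (-w) * riemannZeta w) := by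
  rw [zeta_eq_tsum_one_div_nat_add_one_cpow hw]
  have hsum : Summable fun n : ℕ => 1 / ((n : ℂ) + 1) ^ w := by
    have := (summable_nat_add_iff 1).2 (Complex.summable_one_div_nat_cpow.2 hw)
    simpa using this
  refine (hsum.hasSum.mul_left _).congr_fun ?_
  intro k
  have := Complex.natCast_mul_natCast_cpow 2 (k+1) (-w)
  push_cast at this
  rw [this, Complex.cpow_neg ((k:ℂ)+1), one_div]

noncomputable def Gfun (s w : ℂ) : ℂ :=
  2 ^ (-w) * riemannZeta w - s / 2 * (2 ^ (-w) * riemannZeta₁ (w + 1)) + ∑' k, hTerm s k w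

lemma Gfun_eq (s : ℂ) (hs : 0 < s.re) (w : ℂ) (hw : w ∈ regU) (h1 : 1 < w.re) :
    ∑' k : ℕ, (2 * ((k : ℂ) + 1) + s) ^ (-w) = Gfun s w := by
  obtain ⟨u, hu, hb⟩ := hTerm_bound s hs
  have hH : Summable (fun k => hTerm s k w) := Summable.of_norm_bounded hu (fun k => hb k w hw)
  have s1 := two_cpow_sum w h1
  have s2 := two_cpow_sum (w + 1) (by simp; linarith)
  have hw0 : w ≠ 0 := by rintro rfl; simp at h1; linarith
  have := (hH.hasSum.add s1).sub (s2.mul_left (s * w))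
  have e : ∀ k : ℕ, hTerm s k w + (2 * ((k : ℂ) + 1)) ^ (-w)
      - s * w * (2 * ((k : ℂ) + 1)) ^ (-(w + 1)) = (2 * ((k : ℂ) + 1) + s) ^ (-w) := by
    intro k
    unfold hTerm
    rw [show -(w + 1) = -w - 1 by ring]; ring
  simp only [e] at this
  rw [this.tsum_eq, Gfun, riemannZeta_eq_inv_sub_mul (s := w + 1) (by simpa using hw0),
    show -(w + 1) = -w - 1 by ring, Complex.cpow_sub _ _ two_ne_zero, Complex.cpow_one]
  simp only [add_sub_cancel_right]
  field_simp
  ring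

lemma one_notMem {w : ℂ} (hw : w ∈ regU) : w ≠ 1 := by
  rintro rfl
  have := hw.2.2
  simp at this

lemma hTerm_sum_deriv (s : ℂ) (hs : 0 < s.re) :
    DifferentiableOn ℂ (fun w => ∑' k, hTerm s k w) regU := by
  obtain ⟨u, hu, hb⟩ := hTerm_bound s hs
  exact Complex.differentiableOn_tsum_of_summable_norm hu
    (fun k => (hTerm_differentiable s hs k).differentiableOn) isOpen_regU hb

lemma Gfun_diff (s : ℂ) (hs : 0 < s.re) : DifferentiableOn ℂ (Gfun s) regU := by
  unfold Gfun
  refine DifferentiableOn.add ?_ (hTerm_sum_deriv s hs)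
  intro w hw
  have h2 : DifferentiableAt ℂ (fun w : ℂ => (2:ℂ) ^ (-w)) w :=
    DifferentiableAt.const_cpow (by fun_prop) (Or.inl two_ne_zero)
  have h3 : DifferentiableAt ℂ (fun w : ℂ => riemannZeta₁ (w + 1)) w := by fun_prop
  exact ((h2.mul (differentiableAt_riemannZeta (one_notMem hw))).sub
    ((h2.mul h3).const_mul _)).differentiableWithinAt

lemma zero_mem_regU : (0:ℂ) ∈ regU := by
  refine ⟨?_, ?_, ?_⟩ <;> norm_num

lemma pt_mem_regU : (⟨2, 2⟩ : ℂ) ∈ regU := by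
  refine ⟨by norm_num, ?_, by norm_num⟩
  rw [Complex.norm_def, Real.sqrt_lt' (by norm_num)]
  norm_num [Complex.normSq_mk]

lemma deriv_F (s : ℂ) (hs : 0 < s.re) (F : ℂ → ℂ)
    (hF : ∀ w : ℂ, w ≠ 1 → DifferentiableAt ℂ F w)
    (hFeq : ∀ w : ℂ, 1 < w.re → F w = ∑' k : ℕ, (2 * ((k : ℂ) + 1) + s) ^ (-w)) :
    deriv F 0 = deriv (Gfun s) 0 := by
  have hF' : AnalyticOnNhd ℂ F regU := DifferentiableOn.analyticOnNhd
    (fun w hw => (hF w (one_notMem hw)).differentiableWithinAt) isOpen_regU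
  have hG' := (Gfun_diff s hs).analyticOnNhd isOpen_regU
  have heq : Set.EqOn F (Gfun s) regU := by
    refine hF'.eqOn_of_preconnected_of_eventuallyEq hG' convex_regU.isPreconnected pt_mem_regU ?_
    have o : IsOpen {w : ℂ | 1 < w.re} := isOpen_lt (by fun_prop) (by fun_prop)
    filter_upwards [isOpen_regU.mem_nhds pt_mem_regU,
      o.mem_nhds (show (⟨2,2⟩ : ℂ) ∈ {w : ℂ | 1 < w.re} by simp)] with w h1 h2
    rw [hFeq w h2, Gfun_eq s hs w h1 h2]
  exact (heq.eventuallyEq_of_mem (isOpen_regU.mem_nhds zero_mem_regU)).deriv_eq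

lemma dsum (s : ℂ) (hs : 0 < s.re) :
    Complex.exp (-(deriv (fun w => ∑' k, hTerm s k w) 0)) =
      Complex.exp (-(s / 2) * Real.eulerMascheroniConstant) / (s / 2 * Complex.Gamma (s / 2)) := by
  obtain ⟨u, hu, hb⟩ := hTerm_bound s hs
  have H := Complex.hasSum_deriv_of_summable_norm hu
    (fun k => (hTerm_differentiable s hs k).differentiableOn) isOpen_regU hb zero_mem_regU
  have T := (Complex.continuous_exp.tendsto _).comp (H.tendsto_sum_nat.neg)
  refine tendsto_nhds_unique T ?_
  have ha : 0 < (s / 2).re := by simpa using hs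
  have hG0 := Complex.Gamma_ne_zero_of_re_pos ha
  have ha0 := ne_zero_of_re ha
  have hh : Tendsto (fun n : ℕ => ((harmonic n - Real.log n : ℝ) : ℂ)) atTop
      (𝓝 (Real.eulerMascheroniConstant : ℂ)) :=
    (Complex.continuous_ofReal.tendsto _).comp Real.tendsto_harmonic_sub_log
  have T2 : Tendsto (fun n : ℕ => Complex.exp (-(s / 2) * ((harmonic n - Real.log n : ℝ) : ℂ)) /
      (s / 2 * Complex.GammaSeq (s / 2) n)) atTop (𝓝 (Complex.exp (-(s / 2) *
        Real.eulerMascheroniConstant) / (s / 2 * Complex.Gamma (s / 2)))) := by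
    refine Tendsto.div ?_ ((Complex.GammaSeq_tendsto_Gamma _).const_mul _) (mul_ne_zero ha0 hG0)
    exact (Complex.continuous_exp.tendsto _).comp (hh.const_mul _)
  refine T2.congr' ?_
  filter_upwards [eventually_ge_atTop 1] with n hn
  have hn0 : (n : ℂ) ≠ 0 := by exact_mod_cast (by omega : n ≠ 0)
  simp only [Function.comp]
  rw [← Finset.sum_neg_distrib, Complex.exp_sum]
  have e : ∀ k : ℕ, Complex.exp (-deriv (hTerm s k) 0) =
      ((s / 2 + ((k + 1 : ℕ) : ℂ)) / ((k + 1 : ℕ) : ℂ)) * Complex.exp (-(s / 2) * (((k + 1 : ℕ) : ℂ))⁻¹) := by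
    intro k
    have h1 := ne_zero_of_re (base_re s hs k)
    have h0 := ne_zero_of_re (base_re0 k)
    have hk1 : ((k : ℂ) + 1) ≠ 0 := by exact_mod_cast (Nat.succ_ne_zero k)
    rw [(hTerm_hasDerivAt s hs k).deriv, show -(-Complex.log (2 * ((k : ℂ) + 1) + s)
      + Complex.log (2 * ((k : ℂ) + 1)) + s / (2 * ((k : ℂ) + 1))) =
      Complex.log (2 * ((k : ℂ) + 1) + s) - Complex.log (2 * ((k : ℂ) + 1))
      + -(s / 2) * ((k : ℂ) + 1)⁻¹ by field_simp; ring, Complex.exp_add, Complex.exp_sub,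
      Complex.exp_log h1, Complex.exp_log h0]
    push_cast
    congr 1
    field_simp
    ring
  simp only [e]
  rw [Finset.prod_mul_distrib, ← Complex.exp_sum, ← Finset.mul_sum, Finset.prod_div_distrib,
    Complex.GammaSeq, Finset.prod_range_succ']
  have hf : (∏ k ∈ Finset.range n, ((k + 1 : ℕ) : ℂ)) = (n.factorial : ℂ) := by
    rw [← Finset.prod_range_add_one_eq_factorial]; push_cast; rfl
  have hharm : ((harmonic n : ℝ) : ℂ) = ∑ k ∈ Finset.range n, (((k + 1 : ℕ) : ℂ))⁻¹ := by
    simp [harmonic]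
  have hpr : ∏ k ∈ Finset.range n, (s / 2 + ((k + 1 : ℕ) : ℂ)) ≠ 0 := by
    refine Finset.prod_ne_zero_iff.2 fun k _ => ne_zero_of_re ?_
    rw [Complex.add_re, Complex.natCast_re]; positivity
  have hfac : (n.factorial : ℂ) ≠ 0 := by exact_mod_cast n.factorial_ne_zero
  rw [hf, Complex.ofReal_sub, mul_sub, Complex.exp_sub, hharm, Complex.ofReal_log (by positivity),
    Complex.ofReal_natCast, show -(s/2) * Complex.log (n : ℂ) = -(Complex.log n * (s / 2)) by ring,
    Complex.exp_neg, ← Complex.cpow_def_of_ne_zero hn0]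
  have hp : (n : ℂ) ^ (s / 2) ≠ 0 := by simp [Complex.cpow_eq_zero_iff, hn0]
  generalize ∏ k ∈ Finset.range n, (s / 2 + ((k + 1 : ℕ) : ℂ)) = P at *
  generalize Complex.exp _ = Q
  generalize (n : ℂ) ^ (s / 2) = R at *
  simp only [Nat.cast_zero, add_zero]
  have hs0 := ne_zero_of_re hs
  field_simp

lemma deriv_Gfun (s : ℂ) (hs : 0 < s.re) :
    deriv (Gfun s) 0 = Complex.log 2 / 2 - Complex.log (2 * Real.pi) / 2
      - s / 2 * (Real.eulerMascheroniConstant - Complex.log 2)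
      + deriv (fun w => ∑' k, hTerm s k w) 0 := by
  have hH := ((hTerm_sum_deriv s hs).differentiableAt
    (isOpen_regU.mem_nhds zero_mem_regU)).hasDerivAt
  have e0 := (hasDerivAt_neg (0:ℂ)).const_cpow (c := 2) (Or.inl two_ne_zero)
  have ez := (differentiableAt_riemannZeta (s := 0) zero_ne_one).hasDerivAt
  have ez1 : HasDerivAt (fun w : ℂ => riemannZeta₁ (w + 1)) (Real.eulerMascheroniConstant : ℂ) 0 := by
    have := (differentiable_riemannZeta₁ (0 + 1)).hasDerivAt.comp_add_const 0 1
    simpa using this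
  have := (((e0.mul ez).sub ((e0.mul ez1).const_mul (s / 2))).add hH)
  refine (this.congr_deriv ?_).deriv
  rw [deriv_riemannZeta_zero]
  simp [riemannZeta_zero]
  ring

/-- Lemma 1: the zeta regularized product
`∏_{n>1, n≡1 mod 4} ((n−1)/2 + s) = s⁻¹ · Γ_ℝ(s)⁻¹ · (√(2π))^(−s) · 2√π`,
where the left-hand side is `exp(−F′(0))` for `F` the analytic continuation of
`w ↦ ∑_{k=1}^∞ (2k + s)^(−w)`. -/
theorem lemma_one (s : ℂ) (hs : 0 < s.re) (F : ℂ → ℂ)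
    (hF : ∀ w : ℂ, w ≠ 1 → DifferentiableAt ℂ F w)
    (hFeq : ∀ w : ℂ, 1 < w.re → F w = ∑' k : ℕ, (2 * ((k : ℂ) + 1) + s) ^ (-w)) :
    Complex.exp (-(deriv F 0)) =
      s⁻¹ * (GammaR s)⁻¹ * (Real.sqrt (2 * Real.pi) : ℂ) ^ (-s)
        * (2 * Real.sqrt Real.pi) := by
  have ha : 0 < (s / 2).re := by simpa using hs
  have hG0 := Complex.Gamma_ne_zero_of_re_pos ha
  have hs0 := ne_zero_of_re hs
  have hpi := Real.pi_pos
  have hpc : (Real.pi : ℂ) ≠ 0 := by exact_mod_cast hpi.ne'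
  have l2 : Complex.log 2 = (Real.log 2 : ℂ) := by
    rw [Complex.ofReal_log (by norm_num)]; norm_num
  have lpi : Complex.log Real.pi = (Real.log Real.pi : ℂ) := (Complex.ofReal_log hpi.le).symm
  have l2pi : Complex.log (2 * Real.pi) = (Real.log 2 : ℂ) + Real.log Real.pi := by
    rw [← Complex.ofReal_add, ← Real.log_mul (by norm_num) hpi.ne',
      Complex.ofReal_log (by positivity)]
    push_cast; rfl
  have hq : (Real.sqrt Real.pi : ℂ) = Complex.exp (Real.log Real.pi / 2) := by
    rw [← Real.exp_log (Real.sqrt_pos.2 hpi), Real.log_sqrt hpi.le]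
    push_cast; rfl
  have hq2 : (Real.sqrt (2 * Real.pi) : ℂ) ^ (-s)
      = Complex.exp (-(s / 2) * (Real.log 2 + Real.log Real.pi)) := by
    have hp : 0 < Real.sqrt (2 * Real.pi) := by positivity
    rw [Complex.cpow_def_of_ne_zero (by exact_mod_cast hp.ne'), ← Complex.ofReal_log hp.le,
      Real.log_sqrt (by positivity), Real.log_mul (by norm_num) hpi.ne']
    push_cast; ring_nf
  rw [deriv_F s hs F hF hFeq, deriv_Gfun s hs, neg_add, Complex.exp_add, dsum s hs, hq2, hq,
    GammaR, Complex.cpow_def_of_ne_zero hpc, l2pi, l2, lpi, mul_inv, ← Complex.exp_neg]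
  have key : ∀ A B C D E : ℂ, A + B = C + D + E → ∀ G : ℂ, G ≠ 0 →
      Complex.exp A * (Complex.exp B / (s / 2 * G)) =
      s⁻¹ * (G⁻¹ * Complex.exp C) * Complex.exp D * (2 * Complex.exp E) := by
    intro A B C D E h G hG
    have : Complex.exp A * Complex.exp B = Complex.exp C * Complex.exp D * Complex.exp E := by
      rw [← Complex.exp_add, ← Complex.exp_add, ← Complex.exp_add, h]
    field_simp
    linear_combination this
  apply key _ _ _ _ _ _ _ hG0
  ring
end

section
/- Let s be a complex number with Re(s) > 0. Suppose F : ℂ → ℂ is complex-differentiable at every point w ≠ 1 and satisfies F(w) = ∑_{k=0}^∞ (2k + 1 + s)^(−w) for all w with Re(w) > 1 (principal-branch powers). Then exp(−F′(0)) = Γ_ℝ(s+1)^(−1) · (√(2π))^(−s) · √2. -/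
open Complex
lemma midpoint_bound (c w : ℂ) (ρ B : ℝ) (hρ : 0 < ρ) (hc : ρ + 1 ≤ c.re) (hw : w ≠ 1)
    (hB : ∀ z : ℂ, ρ ≤ z.re → ‖z ^ (-w - 2)‖ ≤ B) :
    ‖((c + 1) ^ (1 - w) - (c - 1) ^ (1 - w)) / (2 * (1 - w)) - c ^ (-w)‖ ≤ ‖w‖ * ‖w + 1‖ * B := by
  have hw1 : (1 - w) ≠ 0 := sub_ne_zero.2 (Ne.symm hw)
  have hball : ∀ t ∈ Metric.closedBall (0 : ℂ) 1, ρ ≤ (c + t).re ∧ ρ ≤ (c - t).re := by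
    intro t ht
    have h1 : ‖t‖ ≤ 1 := by simpa using ht
    have h2 := abs_le.1 ((Complex.abs_re_le_norm t).trans h1)
    simp only [add_re, sub_re]
    constructor <;> linarith [h2.1, h2.2]
  have hsl : ∀ z : ℂ, ρ ≤ z.re → z ∈ slitPlane := fun z hz => Or.inl (hρ.trans_le hz)
  have hB0 : 0 ≤ B := (norm_nonneg _).trans (hB (ρ : ℂ) (by simp))
  have hconv : Convex ℝ {z : ℂ | ρ ≤ z.re} := convex_halfSpace_re_ge ρ
  have s1 : ∀ t ∈ Metric.closedBall (0 : ℂ) 1,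
      ‖(c + t) ^ (-w - 1) - (c - t) ^ (-w - 1)‖ ≤ 2 * (‖w + 1‖ * B) := by
    intro t ht
    have h := hconv.norm_image_sub_le_of_norm_hasDerivWithin_le (𝕜 := ℂ)
      (f := fun z : ℂ => z ^ (-w - 1)) (f' := fun z : ℂ => (-w - 1) * z ^ (-w - 1 - 1))
      (C := ‖w + 1‖ * B) (x := c - t) (y := c + t) ?_ ?_ (hball t ht).2 (hball t ht).1
    · refine h.trans ?_
      have h1 : ‖t‖ ≤ 1 := by simpa using ht
      have h2 : ‖c + t - (c - t)‖ ≤ 2 := by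
        rw [show c + t - (c - t) = 2 * t by ring, norm_mul]; simp; linarith
      have := mul_le_mul_of_nonneg_left h2 (mul_nonneg (norm_nonneg (w + 1)) hB0)
      linarith
    · intro z hz
      exact (((hasDerivAt_id z).cpow_const (c := -w - 1) (hsl z hz)).congr_deriv (by simp)).hasDerivWithinAt
    · intro z hz
      rw [norm_mul, show -w - 1 = -(w + 1) by ring, norm_neg, show -(w + 1) - 1 = -w - 2 by ring]
      exact mul_le_mul_of_nonneg_left (hB z hz) (norm_nonneg _)
  have hder : ∀ p : ℂ, ∀ t ∈ Metric.closedBall (0 : ℂ) 1,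
      HasDerivAt (fun t : ℂ => (c + t) ^ p) (p * (c + t) ^ (p - 1)) t ∧
      HasDerivAt (fun t : ℂ => (c - t) ^ p) (-(p * (c - t) ^ (p - 1))) t := by
    intro p t ht
    refine ⟨?_, ?_⟩
    · exact (((hasDerivAt_id t).const_add c).cpow_const (c := p) (hsl _ (hball t ht).1)).congr_deriv (by simp)
    · exact (((hasDerivAt_id t).const_sub c).cpow_const (c := p) (hsl _ (hball t ht).2)).congr_deriv (by simp)
  have hcb : Convex ℝ (Metric.closedBall (0 : ℂ) 1) := convex_closedBall _ _
  have s2 : ∀ t ∈ Metric.closedBall (0 : ℂ) 1,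
      ‖((c + t) ^ (-w) + (c - t) ^ (-w)) / 2 - c ^ (-w)‖ ≤ ‖w‖ * ‖w + 1‖ * B := by
    intro t ht
    have h := hcb.norm_image_sub_le_of_norm_hasDerivWithin_le (𝕜 := ℂ)
      (f := fun t : ℂ => ((c + t) ^ (-w) + (c - t) ^ (-w)) / 2)
      (f' := fun t : ℂ => (-w / 2) * ((c + t) ^ (-w - 1) - (c - t) ^ (-w - 1)))
      (C := ‖w‖ * ‖w + 1‖ * B) (x := 0) (y := t) ?_ ?_ (by simp) ht
    · simp only [add_zero, sub_zero, add_self_div_two] at h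
      have h1 : ‖t‖ ≤ 1 := by simpa using ht
      refine h.trans (mul_le_of_le_one_right (by positivity) h1)
    · intro z hz
      exact ((((hder (-w) z hz).1.add (hder (-w) z hz).2).div_const 2).congr_deriv (by ring)).hasDerivWithinAt
    · intro z hz
      rw [norm_mul, norm_div, norm_neg]
      have := mul_le_mul_of_nonneg_left (s1 z hz) (norm_nonneg w)
      simp only [Complex.norm_ofNat]
      linarith
  have h := hcb.norm_image_sub_le_of_norm_hasDerivWithin_le (𝕜 := ℂ)
      (f := fun t : ℂ => ((c + t) ^ (1 - w) - (c - t) ^ (1 - w)) / (2 * (1 - w)) - t * c ^ (-w))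
      (f' := fun t : ℂ => ((c + t) ^ (-w) + (c - t) ^ (-w)) / 2 - c ^ (-w))
      (C := ‖w‖ * ‖w + 1‖ * B) (x := 0) (y := 1) ?_ s2 (by simp) (by simp)
  · simpa using h
  · intro z hz
    refine (((((hder (1 - w) z hz).1.sub (hder (1 - w) z hz).2).div_const (2 * (1 - w))).sub
      ((hasDerivAt_id z).mul_const (c ^ (-w)))).congr_deriv ?_).hasDerivWithinAt
    rw [show 1 - w - 1 = -w by ring]
    field_simp
    ring

lemma cpow_bound (z p : ℂ) (m : ℝ) (k : ℕ) (hm : 0 < m) (hm1 : m ≤ 1) (q : ℝ) (hq : q ≤ -p.re)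
    (hq0 : 0 ≤ q) (hp : ‖p‖ ≤ 6) (hz : m * (k + 1) ≤ z.re) :
    ‖z ^ p‖ ≤ (m⁻¹ ^ (6:ℕ) * Real.exp (6 * Real.pi)) * (1 / ((k : ℝ) + 1) ^ q) := by
  have hk : (1:ℝ) ≤ (k : ℝ) + 1 := by simp
  have hmk : 0 < m * (k + 1) := by positivity
  have hzn : m * (k + 1) ≤ ‖z‖ := hz.trans (Complex.re_le_norm z)
  have h6 : -p.re ≤ 6 := ((neg_le_abs _).trans (Complex.abs_re_le_norm p)).trans hp
  have i6 : |p.im| ≤ 6 := (Complex.abs_im_le_norm p).trans hp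
  have e1 : ‖z‖ ^ p.re ≤ m⁻¹ ^ (6:ℕ) * (1 / ((k : ℝ) + 1) ^ q) := by
    calc ‖z‖ ^ p.re ≤ (m * (k + 1)) ^ p.re :=
          Real.rpow_le_rpow_of_nonpos hmk hzn (by linarith)
      _ = (m⁻¹) ^ (-p.re) * ((k : ℝ) + 1) ^ p.re := by
          rw [Real.mul_rpow hm.le (by positivity), Real.inv_rpow hm.le, Real.rpow_neg hm.le, inv_inv]
      _ ≤ (m⁻¹) ^ (6:ℝ) * ((k : ℝ) + 1) ^ (-q) := by
          gcongr
          · exact (one_le_inv₀ hm).2 hm1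
          · linarith
      _ = _ := by
          rw [Real.rpow_neg (by positivity), one_div]; congr 1; exact_mod_cast Real.rpow_natCast _ 6
  refine (Complex.norm_cpow_le z p).trans ?_
  rw [div_eq_mul_inv, ← Real.exp_neg]
  have e2 : Real.exp (-(arg z * p.im)) ≤ Real.exp (6 * Real.pi) := by
    apply Real.exp_le_exp.2
    calc -(arg z * p.im) ≤ |arg z * p.im| := neg_le_abs _
      _ = |arg z| * |p.im| := abs_mul _ _
      _ ≤ Real.pi * 6 := by gcongr; exact Complex.abs_arg_le_pi z
      _ = _ := by ring
  calc _ ≤ m⁻¹ ^ (6:ℕ) * (1 / ((k : ℝ) + 1) ^ q) * Real.exp (6 * Real.pi) := by gcongr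
    _ = _ := by ring
open Filter Topology

/-- Partial sums corrected by the boundary term. -/
noncomputable def TT (s : ℂ) (N : ℕ) (w : ℂ) : ℂ :=
  ∑ k ∈ Finset.range N, (2 * (k : ℂ) + 1 + s) ^ (-w) - (2 * (N : ℂ) + s) ^ (1 - w) / (2 * (1 - w))

def UU : Set ℂ := {w | -1 / 2 < w.re} ∩ {w | w.re - w.im < 1 / 2} ∩ Metric.ball 0 4

lemma UU_open : IsOpen UU := by
  refine IsOpen.inter (IsOpen.inter ?_ ?_) Metric.isOpen_ball
  · exact isOpen_lt continuous_const continuous_re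
  · exact isOpen_lt (continuous_re.sub continuous_im) continuous_const

lemma UU_convex : Convex ℝ UU := by
  refine Convex.inter (Convex.inter ?_ ?_) (convex_ball _ _)
  · exact convex_halfSpace_re_gt _
  · exact convex_halfSpace_lt (f := fun w : ℂ => w.re - w.im)
      ⟨fun x y => by simp; ring, fun c x => by simp; ring⟩ _

lemma UU_ne_one {w : ℂ} (hw : w ∈ UU) : w ≠ 1 := by
  rintro rfl
  have := hw.1.2
  norm_num at this

lemma c_re_pos (s : ℂ) (hs : 0 < s.re) (k : ℕ) : 0 < (2 * (k : ℂ) + 1 + s).re := by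
  have : (0:ℝ) ≤ k := Nat.cast_nonneg k
  simp; linarith

lemma X_re_pos (s : ℂ) (hs : 0 < s.re) (k : ℕ) : 0 < (2 * (k : ℂ) + s).re := by
  have : (0:ℝ) ≤ k := Nat.cast_nonneg k
  simp; linarith

lemma TT_hasDerivAt (s : ℂ) (hs : 0 < s.re) (N : ℕ) (w : ℂ) (hw : w ≠ 1) :
    HasDerivAt (TT s N) (∑ k ∈ Finset.range N, -((2 * (k : ℂ) + 1 + s) ^ (-w) * log (2 * (k : ℂ) + 1 + s))
      - (-((2 * (N : ℂ) + s) ^ (1 - w) * log (2 * (N : ℂ) + s)) * (2 * (1 - w))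
        - (2 * (N : ℂ) + s) ^ (1 - w) * (-2)) / (2 * (1 - w)) ^ 2) w := by
  have hw1 : 2 * (1 - w) ≠ 0 := mul_ne_zero two_ne_zero (sub_ne_zero.2 (Ne.symm hw))
  unfold TT
  refine HasDerivAt.sub ?_ ?_
  · refine HasDerivAt.fun_sum fun k _ => ?_
    exact ((hasDerivAt_neg w).const_cpow (Or.inl (ne_zero_of_re_pos (c_re_pos s hs k)))).congr_deriv
      (by ring)
  · refine HasDerivAt.div ?_ ?_ hw1
    · exact (((hasDerivAt_id w).const_sub 1).const_cpow
        (Or.inl (ne_zero_of_re_pos (X_re_pos s hs N)))).congr_deriv (by simp)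
    · exact (((hasDerivAt_id w).const_sub 1).const_mul 2).congr_deriv (by simp)

lemma TT_step (s w : ℂ) (N : ℕ) : TT s (N + 1) w - TT s N w =
    -((((2 * (N : ℂ) + 1 + s) + 1) ^ (1 - w) - ((2 * (N : ℂ) + 1 + s) - 1) ^ (1 - w)) / (2 * (1 - w))
      - (2 * (N : ℂ) + 1 + s) ^ (-w)) := by
  unfold TT
  rw [Finset.sum_range_succ]
  push_cast
  rw [show 2 * ((N : ℂ) + 1) + s = (2 * (N : ℂ) + 1 + s) + 1 by ring,
    show 2 * (N : ℂ) + s = (2 * (N : ℂ) + 1 + s) - 1 by ring]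
  ring

lemma TT_step_bound (s : ℂ) (hs : 0 < s.re) : ∃ C : ℝ, ∀ (N : ℕ) (w : ℂ), w ∈ UU →
    ‖TT s (N + 1) w - TT s N w‖ ≤ C * (1 / ((N : ℝ) + 1) ^ (3 / 2 : ℝ)) := by
  set m := min s.re 1 with hm
  have hm0 : 0 < m := lt_min hs one_pos
  have hm1 : m ≤ 1 := min_le_right _ _
  have hms : m ≤ s.re := min_le_left _ _
  refine ⟨20 * (m⁻¹ ^ (6:ℕ) * Real.exp (6 * Real.pi)), fun N w hw => ?_⟩
  rw [TT_step, norm_neg]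
  have hN : (0:ℝ) ≤ N := Nat.cast_nonneg N
  have hw4 : ‖w‖ < 4 := by simpa using hw.2
  have hwre : -1 / 2 < w.re := hw.1.1
  have hw5 : ‖w + 1‖ ≤ 5 := (norm_add_le _ _).trans (by simp; linarith)
  refine (midpoint_bound _ w (2 * N + s.re)
    ((m⁻¹ ^ (6:ℕ) * Real.exp (6 * Real.pi)) * (1 / ((N : ℝ) + 1) ^ (3 / 2 : ℝ)))
    (by positivity) (by simp; linarith) (UU_ne_one hw) ?_).trans ?_
  · intro z hz
    apply cpow_bound z _ m N hm0 hm1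
    · simp; linarith
    · norm_num
    · rw [show -w - 2 = -(w + 2) by ring, norm_neg]
      exact (norm_add_le _ _).trans (by simp; linarith)
    · nlinarith
  · have : ‖w‖ * ‖w + 1‖ ≤ 20 := by nlinarith [norm_nonneg w, norm_nonneg (w + 1)]
    rw [mul_assoc 20]
    gcongr

lemma summ_aux (q : ℝ) (hq : 1 < q) : Summable (fun k : ℕ => 1 / ((k : ℝ) + 1) ^ q) := by
  refine ((Real.summable_one_div_nat_add_rpow 1 q).2 hq).congr fun k => ?_
  rw [abs_of_pos (by positivity)]

lemma TT_tendsto (s : ℂ) (hs : 0 < s.re) : ∃ G : ℂ → ℂ, TendstoUniformlyOn (TT s) G atTop UU := by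
  obtain ⟨C, hC⟩ := TT_step_bound s hs
  have h := tendstoUniformlyOn_tsum_nat (f := fun N w => TT s (N + 1) w - TT s N w)
    ((summ_aux (3 / 2) (by norm_num)).mul_left C) hC
  refine ⟨fun w => (∑' n, (TT s (n + 1) w - TT s n w)) + TT s 0 w, ?_⟩
  rw [Metric.tendstoUniformlyOn_iff] at h ⊢
  intro ε hε
  filter_upwards [h ε hε] with N hN w hw
  have := hN w hw
  rw [Finset.sum_range_sub (fun n => TT s n w)] at this
  rw [dist_eq_norm] at this ⊢
  convert this using 2
  ring

lemma TT_tendsto_sum (s : ℂ) (hs : 0 < s.re) (w : ℂ) (hw : w ∈ UU) (hw1 : 1 < w.re) :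
    Tendsto (fun N => TT s N w) atTop (𝓝 (∑' k : ℕ, (2 * (k : ℂ) + 1 + s) ^ (-w))) := by
  set m := min s.re 1 with hm
  have hm0 : 0 < m := lt_min hs one_pos
  have hm1 : m ≤ 1 := min_le_right _ _
  have hms : m ≤ s.re := min_le_left _ _
  have hw4 : ‖w‖ < 4 := by simpa using hw.2
  have hsum : Summable (fun k : ℕ => (2 * (k : ℂ) + 1 + s) ^ (-w)) := by
    refine Summable.of_norm_bounded ((summ_aux w.re hw1).mul_left
      (m⁻¹ ^ (6:ℕ) * Real.exp (6 * Real.pi))) fun k => ?_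
    apply cpow_bound _ _ m k hm0 hm1
    · simp
    · linarith
    · simp; linarith
    · have hN : (0:ℝ) ≤ k := Nat.cast_nonneg k
      simp; nlinarith
  have h0 : Tendsto (fun N : ℕ => (2 * (N : ℂ) + s) ^ (1 - w)) atTop (𝓝 0) := by
    have hb : ∀ N : ℕ, ‖(2 * (N : ℂ) + s) ^ (1 - w)‖ ≤
        (m⁻¹ ^ (6:ℕ) * Real.exp (6 * Real.pi)) * (1 / ((N : ℝ) + 1) ^ (w.re - 1)) := by
      intro k
      apply cpow_bound _ _ m k hm0 hm1
      · simp
      · linarith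
      · exact (norm_sub_le _ _).trans (by simp; linarith)
      · have hN : (0:ℝ) ≤ k := Nat.cast_nonneg k
        simp; nlinarith
    refine squeeze_zero_norm hb ?_
    rw [← mul_zero (m⁻¹ ^ (6:ℕ) * Real.exp (6 * Real.pi))]
    refine Tendsto.const_mul _ ?_
    simp only [one_div]
    refine Tendsto.inv_tendsto_atTop ?_
    exact (tendsto_rpow_atTop (by linarith)).comp
      (tendsto_atTop_add_const_right _ _ tendsto_natCast_atTop_atTop)
  have := hsum.hasSum.tendsto_sum_nat.sub (h0.div_const (2 * (1 - w)))
  simpa [TT] using this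

lemma deriv_tendsto (s : ℂ) (hs : 0 < s.re) (F : ℂ → ℂ)
    (hF : ∀ w : ℂ, w ≠ 1 → DifferentiableAt ℂ F w)
    (hFeq : ∀ w : ℂ, 1 < w.re → F w = ∑' k : ℕ, (2 * (k : ℂ) + 1 + s) ^ (-w)) :
    Tendsto (fun N => deriv (TT s N) 0) atTop (𝓝 (deriv F 0)) := by
  obtain ⟨G, hG⟩ := TT_tendsto s hs
  have hT : ∀ N, DifferentiableOn ℂ (TT s N) UU := fun N w hw =>
    (TT_hasDerivAt s hs N w (UU_ne_one hw)).differentiableAt.differentiableWithinAt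
  have hloc := hG.tendstoLocallyUniformlyOn
  have hGd : DifferentiableOn ℂ G UU :=
    hloc.differentiableOn (Eventually.of_forall hT) UU_open
  have hFd : DifferentiableOn ℂ F UU := fun w hw => (hF w (UU_ne_one hw)).differentiableWithinAt
  have h0 : (0 : ℂ) ∈ UU := by
    refine ⟨⟨?_, ?_⟩, ?_⟩ <;> norm_num
  have h1 : (2 + 3 * I : ℂ) ∈ UU := by
    refine ⟨⟨?_, ?_⟩, ?_⟩
    · norm_num
    · norm_num
    · rw [mem_ball_zero_iff]
      have : ‖(2 + 3 * I : ℂ)‖ ^ 2 = 13 := by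
        rw [Complex.sq_norm, Complex.normSq_apply]; norm_num
      nlinarith [norm_nonneg (2 + 3 * I : ℂ)]
  have hev : F =ᶠ[𝓝 (2 + 3 * I)] G := by
    have hre : {w : ℂ | 1 < w.re} ∈ 𝓝 (2 + 3 * I : ℂ) :=
      (isOpen_lt continuous_const continuous_re).mem_nhds (by norm_num)
    filter_upwards [hre, UU_open.mem_nhds h1] with w hw hwU
    rw [hFeq w hw]
    exact tendsto_nhds_unique (TT_tendsto_sum s hs w hwU hw) (hG.tendsto_at hwU)
  have heq : Set.EqOn F G UU := (hFd.analyticOnNhd UU_open).eqOn_of_preconnected_of_eventuallyEq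
    (hGd.analyticOnNhd UU_open) UU_convex.isPreconnected h1 hev
  have hd : deriv F 0 = deriv G 0 :=
    (heq.eventuallyEq_of_mem (UU_open.mem_nhds h0)).deriv_eq
  rw [hd]
  exact (hloc.deriv (Eventually.of_forall hT) UU_open).tendsto_at h0

lemma deriv_TT_zero (s : ℂ) (hs : 0 < s.re) (N : ℕ) : Complex.exp (-(deriv (TT s N) 0)) =
    (∏ k ∈ Finset.range N, (2 * (k : ℂ) + 1 + s)) *
      Complex.exp (-((2 * (N : ℂ) + s) / 2 * (log (2 * (N : ℂ) + s) - 1))) := by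
  rw [(TT_hasDerivAt s hs N 0 (by norm_num)).deriv]
  simp only [neg_zero, cpow_zero, sub_zero, cpow_one, one_mul, mul_one, Finset.sum_neg_distrib]
  rw [show ∀ S : ℂ, -(-S - (-((2 * (N : ℂ) + s) * log (2 * (N : ℂ) + s)) * 2 - (2 * (N : ℂ) + s) * -2) / 2 ^ 2)
    = S + -((2 * (N : ℂ) + s) / 2 * (log (2 * (N : ℂ) + s) - 1)) by intro S; ring, Complex.exp_add,
    Complex.exp_sum]
  congr 1
  exact Finset.prod_congr rfl fun k _ => Complex.exp_log (ne_zero_of_re_pos (c_re_pos s hs k))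

lemma key_identity (s : ℂ) (hs : 0 < s.re) (n : ℕ) (hn : n ≠ 0) :
    (∏ k ∈ Finset.range (n + 1), (2 * (k : ℂ) + 1 + s)) *
      Complex.exp (-((2 * ((n + 1 : ℕ) : ℂ) + s) / 2 * (log (2 * ((n + 1 : ℕ) : ℂ) + s) - 1))) =
    (GammaSeq ((s + 1) / 2) n)⁻¹ * (Stirling.stirlingSeq n : ℂ) *
      Complex.exp ((s / 2 + 1) - (n * log (1 + (s / 2 + 1) / n) + (s / 2 + 1) * log (1 + (s / 2 + 1) / n))) *
      Complex.exp ((1 - s) / 2 * (Real.log 2 : ℂ)) := by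
  set b : ℂ := s / 2 + 1 with hb
  have hn0 : (n : ℂ) ≠ 0 := Nat.cast_ne_zero.2 hn
  have hnp : (0:ℝ) < n := by positivity
  set y : ℂ := n + b with hy
  have hbre : 0 < b.re := by simp [hb]; linarith
  have hyre : 0 < y.re := by simp [hy]; linarith
  have hX : 2 * ((n + 1 : ℕ) : ℂ) + s = ((2:ℝ) : ℂ) * y := by
    rw [hy, hb]; push_cast; ring
  have h1b : (1 + b / n : ℂ) ≠ 0 := by
    intro h
    apply ne_zero_of_re_pos hyre
    rw [hy, show (n : ℂ) + b = n * (1 + b / n) by field_simp, h, mul_zero]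
  have hlog : log (2 * ((n + 1 : ℕ) : ℂ) + s) = Real.log 2 + Real.log n + log (1 + b / n) := by
    rw [hX, Complex.log_ofReal_mul two_pos (ne_zero_of_re_pos hyre), hy,
      show (n : ℂ) + b = ((n : ℝ) : ℂ) * (1 + b / n) by push_cast; field_simp,
      Complex.log_ofReal_mul hnp h1b]
    ring
  have hprod : (∏ k ∈ Finset.range (n + 1), (2 * (k : ℂ) + 1 + s)) =
      2 ^ (n + 1) * ∏ j ∈ Finset.range (n + 1), ((s + 1) / 2 + j) := by
    rw [← Finset.card_range (n + 1), ← Finset.prod_const, Finset.card_range, ← Finset.prod_mul_distrib]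
    exact Finset.prod_congr rfl fun k _ => by ring
  have hP : ∏ j ∈ Finset.range (n + 1), ((s + 1) / 2 + (j : ℂ)) ≠ 0 := by
    refine Finset.prod_ne_zero_iff.2 fun j _ => ne_zero_of_re_pos ?_
    have : (0:ℝ) ≤ j := Nat.cast_nonneg j
    simp; linarith
  have hfac : (n.factorial : ℂ) = (Stirling.stirlingSeq n : ℂ) *
      Complex.exp ((1 / 2) * Real.log 2 + (1 / 2) * Real.log n + n * Real.log n - n) := by
    have : (n.factorial : ℝ) = Stirling.stirlingSeq n *
      Real.exp ((1 / 2) * Real.log 2 + (1 / 2) * Real.log n + n * Real.log n - n) := by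
      have e1 : √(2 * n : ℝ) * (n / Real.exp 1) ^ n =
          Real.exp ((1 / 2) * Real.log 2 + (1 / 2) * Real.log n + n * Real.log n - n) := by
        have e2 : √(2 * n : ℝ) = Real.exp ((1 / 2) * Real.log 2 + (1 / 2) * Real.log n) := by
          rw [Real.sqrt_eq_rpow, Real.rpow_def_of_pos (by positivity),
            Real.log_mul two_ne_zero hnp.ne']
          congr 1; ring
        have e3 : (n / Real.exp 1 : ℝ) = Real.exp (Real.log n - 1) := by
          rw [Real.exp_sub, Real.exp_log hnp]
        rw [e2, e3, ← Real.exp_nat_mul, ← Real.exp_add]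
        congr 1; ring
      rw [← e1, Stirling.stirlingSeq, div_mul_cancel₀]
      rw [e1]; exact (Real.exp_pos _).ne'
    have h2 := congrArg (fun x : ℝ => (x : ℂ)) this
    push_cast at h2 ⊢
    exact h2
  have hgam : (GammaSeq ((s + 1) / 2) n)⁻¹ = (∏ j ∈ Finset.range (n + 1), ((s + 1) / 2 + (j : ℂ))) /
      (Complex.exp ((s + 1) / 2 * Real.log n) * n.factorial) := by
    rw [GammaSeq, inv_div, cpow_def_of_ne_zero hn0, ← Complex.natCast_log]
    congr 3; ring
  have hst : (Stirling.stirlingSeq n : ℂ) ≠ 0 := by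
    intro h; rw [h, zero_mul] at hfac
    exact Nat.factorial_ne_zero n (by exact_mod_cast hfac)
  have h2p : (2 : ℂ) ^ (n + 1) = Complex.exp ((n + 1) * Real.log 2) := by
    have := Complex.exp_nat_mul (Real.log 2 : ℂ) (n + 1)
    rw [← Complex.ofReal_exp, Real.exp_log two_pos] at this
    push_cast at this ⊢
    exact this.symm
  rw [hgam, hprod, hlog, hfac, h2p, hX]
  have hD : Complex.exp ((s + 1) / 2 * Real.log n) * ((Stirling.stirlingSeq n : ℂ) *
      Complex.exp ((1 / 2) * Real.log 2 + (1 / 2) * Real.log n + n * Real.log n - n)) ≠ 0 :=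
    mul_ne_zero (Complex.exp_ne_zero _) (mul_ne_zero hst (Complex.exp_ne_zero _))
  clear hgam hprod hP hfac
  generalize (Stirling.stirlingSeq n : ℂ) = S at hD ⊢
  generalize (∏ j ∈ Finset.range (n + 1), ((s + 1) / 2 + (j : ℂ))) = P
  rw [mul_assoc (_ / _), mul_assoc (_ / _), div_mul_eq_mul_div P, eq_div_iff hD]
  generalize log (1 + b / n) = L
  have hE : ∀ A B C D E F : ℂ, A + B + C + D = E + F →
      Complex.exp A * P * Complex.exp B * (Complex.exp C * (S * Complex.exp D)) =
      P * (S * Complex.exp E * Complex.exp F) := by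
    intro A B C D E F h
    have : Complex.exp A * Complex.exp B * Complex.exp C * Complex.exp D = Complex.exp E * Complex.exp F := by
      rw [← Complex.exp_add, ← Complex.exp_add, ← Complex.exp_add, ← Complex.exp_add, h]
    linear_combination P * S * this
  apply hE
  rw [hy, hb]
  push_cast
  ring

lemma final_limit (s : ℂ) (hs : 0 < s.re) :
    Tendsto (fun N => Complex.exp (-(deriv (TT s N) 0))) atTop
      (𝓝 ((Gamma ((s + 1) / 2))⁻¹ * (√Real.pi : ℂ) * Complex.exp ((1 - s) / 2 * (Real.log 2 : ℂ)))) := by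
  rw [← tendsto_add_atTop_iff_nat 1]
  have hG : Gamma ((s + 1) / 2) ≠ 0 := Gamma_ne_zero_of_re_pos (by simp; linarith)
  have hl : Tendsto (fun n : ℕ => (n : ℂ) * log (1 + (s / 2 + 1) / n)) atTop (𝓝 (s / 2 + 1)) := by
    apply tendsto_nat_mul_log_one_add_of_tendsto
    refine tendsto_const_nhds.congr' ?_
    filter_upwards [eventually_ne_atTop 0] with n hn
    field_simp
  have hl2 : Tendsto (fun n : ℕ => log (1 + (s / 2 + 1) / n)) atTop (𝓝 0) := by
    have := (tendsto_inv_atTop_nhds_zero_nat (𝕜 := ℂ)).mul hl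
    rw [zero_mul] at this
    refine this.congr' ?_
    filter_upwards [eventually_ne_atTop 0] with n hn
    field_simp
  have hexp : Tendsto (fun n : ℕ => Complex.exp ((s / 2 + 1) - (n * log (1 + (s / 2 + 1) / n) +
      (s / 2 + 1) * log (1 + (s / 2 + 1) / n)))) atTop (𝓝 1) := by
    have := (Complex.continuous_exp.tendsto _).comp
      ((hl.add (hl2.const_mul (s / 2 + 1))).const_sub (s / 2 + 1))
    simp only [mul_zero, add_zero, sub_self, Complex.exp_zero] at this
    exact this
  have hS : Tendsto (fun n : ℕ => (Stirling.stirlingSeq n : ℂ)) atTop (𝓝 (√Real.pi : ℂ)) :=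
    (Complex.continuous_ofReal.tendsto _).comp Stirling.tendsto_stirlingSeq_sqrt_pi
  have := ((((GammaSeq_tendsto_Gamma ((s + 1) / 2)).inv₀ hG).mul hS).mul hexp).mul_const
    (Complex.exp ((1 - s) / 2 * (Real.log 2 : ℂ)))
  rw [mul_one] at this
  refine this.congr' ?_
  filter_upwards [eventually_ne_atTop 0] with n hn
  rw [deriv_TT_zero s hs, key_identity s hs n hn]

theorem lemma_two (s : ℂ) (hs : 0 < s.re) (F : ℂ → ℂ)
    (hF : ∀ w : ℂ, w ≠ 1 → DifferentiableAt ℂ F w)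
    (hFeq : ∀ w : ℂ, 1 < w.re → F w = ∑' k : ℕ, (2 * (k : ℂ) + 1 + s) ^ (-w)) :
    Complex.exp (-(deriv F 0)) =
      (GammaR (s + 1))⁻¹ * (Real.sqrt (2 * Real.pi) : ℂ) ^ (-s)
        * (Real.sqrt 2 : ℂ) := by
  have h1 : Tendsto (fun N => Complex.exp (-(deriv (TT s N) 0))) atTop
      (𝓝 (Complex.exp (-(deriv F 0)))) :=
    (Complex.continuous_exp.tendsto _).comp (deriv_tendsto s hs F hF hFeq).neg
  rw [tendsto_nhds_unique h1 (final_limit s hs)]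
  have hpi := Real.pi_pos
  have sq : ∀ x : ℝ, 0 < x → √x = Real.exp (Real.log x / 2) := by
    intro x hx
    rw [← Real.log_sqrt hx.le, Real.exp_log (Real.sqrt_pos.2 hx)]
  have hpc : ∀ x : ℝ, 0 < x → ∀ p : ℂ, (x : ℂ) ^ p = Complex.exp (Real.log x * p) := by
    intro x hx p
    rw [cpow_def_of_ne_zero (by exact_mod_cast hx.ne'), Complex.ofReal_log hx.le]
  rw [GammaR, hpc _ hpi, hpc _ (Real.sqrt_pos.2 (by positivity)), Real.log_sqrt (by positivity),
    Real.log_mul two_ne_zero hpi.ne', sq _ hpi, sq _ two_pos, mul_inv, ← Complex.exp_neg,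
    Complex.ofReal_exp, Complex.ofReal_exp]
  simp only [mul_assoc, ← Complex.exp_add]
  congr 2
  push_cast
  ring
end
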